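/- Let d > 0, let Ω ⊂ ℝ³ be an open bounded domain with smooth boundary, and let a : cl(Ω) → ℝ³ be a continuously differentiable vector field with div a = 0 on Ω. Assume f satisfies (F), g satisfies (G-ext), f'(0) + ln(g'(0)) > 0, and vol(Ω) < V_ex := (18√3·π²/(5√5))·(d/(f'(0) + ln(g'(0))))^{3/2}. Then every solution of the impulsive reaction–diffusion system on Ω satisfies lim_{m→∞} N_m(x) = 0 for every x ∈ Ω. -/

import Mathlib

open Real Filter MeasureTheory
open scoped Topology ENNReal

noncomputable section

/-- First-order partial derivative of `u` in the `i`-th coordinate direction. -/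
def pd {n : ℕ} (u : EuclideanSpace ℝ (Fin n) → ℝ) (i : Fin n)
    (x : EuclideanSpace ℝ (Fin n)) : ℝ :=
  fderiv ℝ u x (EuclideanSpace.single i 1)

/-- Second-order partial derivative `∂ᵢ∂ⱼ u`. -/
def pd2 {n : ℕ} (u : EuclideanSpace ℝ (Fin n) → ℝ) (i j : Fin n)
    (x : EuclideanSpace ℝ (Fin n)) : ℝ :=
  pd (fun y => pd u j y) i x

/-- Laplacian of `u`. -/
def lap {n : ℕ} (u : EuclideanSpace ℝ (Fin n) → ℝ) (x : EuclideanSpace ℝ (Fin n)) : ℝ :=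
  ∑ i, pd2 u i i x

/-- Assumption (F): `f` is locally Lipschitz, `f 0 = 0`, `f` is differentiable at `0`
with derivative `f'0 ≠ 0`, and there is a differentiable `h` with `h 0 = h' 0 = 0` such that
`f'0 * N - h N ≤ f N ≤ f'0 * N` for all `N ≥ 0`. -/
def SatF (f : ℝ → ℝ) (f'0 : ℝ) : Prop :=
  LocallyLipschitz f ∧ f 0 = 0 ∧ HasDerivAt f f'0 0 ∧ f'0 ≠ 0 ∧
    ∃ h : ℝ → ℝ, Differentiable ℝ h ∧ h 0 = 0 ∧ deriv h 0 = 0 ∧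
      ∀ N : ℝ, 0 ≤ N → f'0 * N - h N ≤ f N ∧ f N ≤ f'0 * N

/-- Assumption (G-ext): `g : [0,∞) → [0,∞)` is continuous, `g 0 = 0`, `g N > 0` for `N > 0`,
`g` is differentiable at `0` (within `[0,∞)`) with derivative `g'0 > 0`, and
`g N ≤ g'0 * N` for all `N > 0`. -/
def SatGext (g : ℝ → ℝ) (g'0 : ℝ) : Prop :=
  ContinuousOn g (Set.Ici 0) ∧ g 0 = 0 ∧ (∀ N : ℝ, 0 < N → 0 < g N) ∧
    HasDerivWithinAt g g'0 (Set.Ici 0) 0 ∧ 0 < g'0 ∧ ∀ N : ℝ, 0 < N → g N ≤ g'0 * N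

/-- `Ω` has a `C^k` boundary: near every boundary point, `Ω` is the sublevel set of a
`C^k` function with nonvanishing differential, whose zero set is the boundary. -/
def HasCkBoundary {n : ℕ} (k : ℕ∞) (Ω : Set (EuclideanSpace ℝ (Fin n))) : Prop :=
  ∀ x ∈ frontier Ω, ∃ U : Set (EuclideanSpace ℝ (Fin n)),
    ∃ φ : EuclideanSpace ℝ (Fin n) → ℝ,
      IsOpen U ∧ x ∈ U ∧ ContDiffOn ℝ k φ U ∧ (∀ y ∈ U, fderiv ℝ φ y ≠ 0) ∧
        Ω ∩ U = {y ∈ U | φ y < 0} ∧ frontier Ω ∩ U = {y ∈ U | φ y = 0}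

/-- A solution of the impulsive reaction-diffusion system
`∂ₜ u⁽ᵐ⁾ = d Δu⁽ᵐ⁾ - a ⬝ ∇u⁽ᵐ⁾ + f (u⁽ᵐ⁾)` on `Ω × (0,1]` with hostile (Dirichlet) boundary
conditions, initial data `u⁽ᵐ⁾(·,0) = g (N_m ·)` and update rule `N_{m+1} = u⁽ᵐ⁾(·,1)`. -/
structure ImpSol (n : ℕ) (Ω : Set (EuclideanSpace ℝ (Fin n))) (d : ℝ)
    (a : EuclideanSpace ℝ (Fin n) → EuclideanSpace ℝ (Fin n)) (f g : ℝ → ℝ) where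
  N : ℕ → EuclideanSpace ℝ (Fin n) → ℝ
  u : ℕ → EuclideanSpace ℝ (Fin n) → ℝ → ℝ
  N_cont : ∀ m, ContinuousOn (N m) (closure Ω)
  N_nonneg : ∀ m, ∀ x ∈ closure Ω, 0 ≤ N m x
  N0_bdry : ∀ x ∈ frontier Ω, N 0 x = 0
  u_nonneg : ∀ m, ∀ x ∈ closure Ω, ∀ t ∈ Set.Icc (0:ℝ) 1, 0 ≤ u m x t
  u_cont : ∀ m, ContinuousOn (fun p : EuclideanSpace ℝ (Fin n) × ℝ => u m p.1 p.2)
    (closure Ω ×ˢ Set.Icc (0:ℝ) 1)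
  u_space_C2 : ∀ m, ∀ t ∈ Set.Ioc (0:ℝ) 1, ∀ x ∈ Ω, ContDiffAt ℝ 2 (fun y => u m y t) x
  u_time_C1 : ∀ m, ∀ x ∈ Ω, ∀ t ∈ Set.Ioc (0:ℝ) 1, ContDiffAt ℝ 1 (fun s => u m x s) t
  pde : ∀ m, ∀ x ∈ Ω, ∀ t ∈ Set.Ioc (0:ℝ) 1,
    deriv (fun s => u m x s) t =
      d * lap (fun y => u m y t) x - (∑ i, a x i * pd (fun y => u m y t) i x) + f (u m x t)
  bdry : ∀ m, ∀ x ∈ frontier Ω, ∀ t ∈ Set.Ioc (0:ℝ) 1, u m x t = 0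
  init : ∀ m, ∀ x ∈ Ω, u m x 0 = g (N m x)
  recur : ∀ m, ∀ x ∈ closure Ω, N (m + 1) x = u m x 1

abbrev E3 := EuclideanSpace ℝ (Fin 3)

open scoped ContDiff

lemma int_bathtub (R : ℝ) (hR : 0 < R) :
    Integrable (fun x : E3 => max (R ^ 2 - ‖x‖ ^ 2) 0) ∧
    ∫ x : E3, max (R ^ 2 - ‖x‖ ^ 2) 0 = 8 * π / 15 * R ^ 5 := by
  constructor
  · apply Continuous.integrable_of_hasCompactSupport (by fun_prop)
    apply HasCompactSupport.intro (isCompact_closedBall (0 : E3) R)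
    intro x hx
    simp only [Metric.mem_closedBall, dist_zero_right, not_le] at hx
    rw [max_eq_right]
    nlinarith
  · have h := integral_fun_norm_addHaar (volume : Measure E3) (fun r : ℝ => max (R ^ 2 - r ^ 2) 0)
    rw [h]
    have hb : (volume : Measure E3).real (Metric.ball 0 1) = π * 4 / 3 := by
      rw [Measure.real, EuclideanSpace.volume_ball_fin_three]
      simp
      positivity
    have hi : ∫ y in Set.Ioi (0 : ℝ), y ^ (Module.finrank ℝ E3 - 1) • max (R ^ 2 - y ^ 2) 0
        = 2 / 15 * R ^ 5 := by
      have e1 : ∫ y in Set.Ioi (0 : ℝ), y ^ (Module.finrank ℝ E3 - 1) • max (R ^ 2 - y ^ 2) 0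
          = ∫ y in Set.Ioc (0 : ℝ) R, y ^ 2 * (R ^ 2 - y ^ 2) := by
        have : ∀ y ∈ Set.Ioc (0:ℝ) R, y ^ 2 * (R ^ 2 - y ^ 2) =
            y ^ (Module.finrank ℝ E3 - 1) • max (R ^ 2 - y ^ 2) 0 := by
          intro y hy
          rw [max_eq_left (by nlinarith [hy.1, hy.2])]
          simp
        rw [setIntegral_congr_fun measurableSet_Ioc this]
        apply setIntegral_eq_of_subset_of_forall_sdiff_eq_zero measurableSet_Ioi
        · intro y hy; exact hy.1
        · intro y hy
          have h1 : 0 < y := hy.1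
          have h2 : R < y := by
            by_contra hc
            exact hy.2 ⟨h1, not_lt.mp hc⟩
          rw [max_eq_right (by nlinarith)]
          simp
      rw [e1, ← intervalIntegral.integral_of_le hR.le]
      have : (fun y : ℝ => y ^ 2 * (R ^ 2 - y ^ 2)) = fun y => R ^ 2 * y ^ 2 - y ^ 4 := by
        funext y; ring
      rw [this, intervalIntegral.integral_sub (Continuous.intervalIntegrable (by fun_prop) _ _)
        (Continuous.intervalIntegrable (by fun_prop) _ _)]
      · rw [intervalIntegral.integral_const_mul, integral_pow, integral_pow]
        norm_num
        ring
    rw [hi, hb]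
    simp
    ring



lemma l1_l2 (v : E3 → ℝ) (hv : Continuous v) (hc : HasCompactSupport v) (V : ℝ) (hV : 0 < V)
    (hs : volume (tsupport v) ≤ ENNReal.ofReal V) :
    (∫ x, |v x|) ^ 2 ≤ V * ∫ x, v x ^ 2 := by
  set A := ∫ x, |v x| with hA
  set S := tsupport v with hS
  have hSm : MeasurableSet S := (isClosed_tsupport v).measurableSet
  have hSf : volume S < ⊤ := hc.isCompact.measure_lt_top
  have i1 : Integrable (fun x => |v x|) := hv.abs.integrable_of_hasCompactSupport hc.abs
  have i2 : Integrable (fun x => v x ^ 2) :=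
    (hv.pow 2).integrable_of_hasCompactSupport (by
      have := hc.mul_right (f' := v)
      simpa [pow_two, Pi.mul_def] using! this)
  have e1 : ∫ x in S, |v x| = A := by
    apply setIntegral_eq_integral_of_forall_compl_eq_zero
    intro x hx
    rw [image_eq_zero_of_notMem_tsupport hx, abs_zero]
  have e2 : ∫ x in S, v x ^ 2 = ∫ x, v x ^ 2 := by
    apply setIntegral_eq_integral_of_forall_compl_eq_zero
    intro x hx
    rw [image_eq_zero_of_notMem_tsupport hx]; simp
  have hr : volume.real S ≤ V := ENNReal.toReal_le_of_le_ofReal hV.le hs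
  set c := A / V with hcdef
  have ic : IntegrableOn (fun _ : E3 => c ^ 2) S := integrableOn_const hSf.ne
  have h0 : 0 ≤ ∫ x in S, (v x ^ 2 - 2 * c * |v x| + c ^ 2) := by
    apply integral_nonneg
    intro x
    have : v x ^ 2 - 2 * c * |v x| + c ^ 2 = (|v x| - c) ^ 2 := by
      rw [← sq_abs (v x)]; ring
    simp only [Pi.zero_apply]
    rw [this]; positivity
  have h1 : ∫ x in S, (v x ^ 2 - 2 * c * |v x| + c ^ 2) =
      (∫ x, v x ^ 2) - 2 * c * A + c ^ 2 * volume.real S := by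
    have i3 : IntegrableOn (fun x => v x ^ 2 - 2 * c * |v x|) S :=
      i2.integrableOn.sub (i1.integrableOn.const_mul _)
    rw [integral_add i3 ic,
      integral_sub i2.integrableOn (i1.integrableOn.const_mul _), integral_const_mul, e1, e2]
    simp [mul_comm]
  rw [h1] at h0
  have h2 : c ^ 2 * volume.real S ≤ c ^ 2 * V := by gcongr
  have h3 : 0 ≤ (∫ x, v x ^ 2) - 2 * c * A + c ^ 2 * V := by linarith
  have h4 : c * V = A := by rw [hcdef]; field_simp
  have h5 : 0 ≤ V * ((∫ x, v x ^ 2) - 2 * c * A + c ^ 2 * V) := by positivity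
  nlinarith

open SchwartzMap FourierTransform LineDeriv in
lemma liyau (v : E3 → ℝ) (hv : ContDiff ℝ ∞ v) (hc : HasCompactSupport v) (V : ℝ) (hV : 0 < V)
    (hs : volume (tsupport v) ≤ ENNReal.ofReal V) (R : ℝ) (hR : 0 < R) :
    4 * π ^ 2 * R ^ 2 * (1 - V * (8 * π / 15) * R ^ 3) * ∫ x, v x ^ 2 ≤
      ∫ x, ∑ i, pd v i x ^ 2 := by
  have hvc : ContDiff ℝ ∞ (fun x => (v x : ℂ)) := Complex.ofRealCLM.contDiff.comp hv
  have hcc : HasCompactSupport (fun x => (v x : ℂ)) := hc.comp_left (g := ((↑) : ℝ → ℂ)) (by simp)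
  set f : 𝓢(E3, ℂ) := hcc.toSchwartzMap hvc with hf
  have hfx : ∀ x, f x = (v x : ℂ) := fun x => rfl
  have P0 : ∫ ξ, ‖𝓕 f ξ‖ ^ 2 = ∫ x, v x ^ 2 := by
    rw [integral_norm_sq_fourier]
    simp [hfx]
  have hd : ∀ (i : Fin 3) x, (∂_{(EuclideanSpace.single i (1:ℝ) : E3)} f) x = (pd v i x : ℂ) := by
    intro i x
    rw [lineDerivOp_apply_eq_fderiv]
    have h1 : HasFDerivAt (fun x => (v x : ℂ)) (Complex.ofRealCLM ∘L fderiv ℝ v x) x :=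
      Complex.ofRealCLM.hasFDerivAt.comp x
        ((hv.differentiable (by simp)) x).hasFDerivAt
    have h2 : fderiv ℝ (⇑f) x = Complex.ofRealCLM ∘L fderiv ℝ v x := h1.fderiv
    rw [h2]; rfl
  have P1 : ∀ i : Fin 3, ∫ ξ, ‖𝓕 (∂_{(EuclideanSpace.single i (1:ℝ) : E3)} f) ξ‖ ^ 2
      = ∫ x, pd v i x ^ 2 := by
    intro i
    rw [integral_norm_sq_fourier]
    simp [hd]
  have hF : ∀ (i : Fin 3) ξ, ‖𝓕 (∂_{(EuclideanSpace.single i (1:ℝ) : E3)} f) ξ‖ ^ 2 =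
      4 * π ^ 2 * ξ i ^ 2 * ‖𝓕 f ξ‖ ^ 2 := by
    intro i ξ
    rw [fourier_lineDerivOp_eq]
    have : (fun x : E3 => inner ℝ x (EuclideanSpace.single i (1:ℝ))).HasTemperateGrowth :=
      ((innerSL ℝ).flip (EuclideanSpace.single i (1:ℝ))).hasTemperateGrowth
    have hin : inner ℝ ξ (EuclideanSpace.single i (1:ℝ)) = ξ i := by
      rw [EuclideanSpace.inner_single_right]; simp
    simp only [smul_apply, smulLeftCLM_apply_apply this, hin, norm_smul, mul_pow]
    simp [abs_of_pos pi_pos, mul_pow]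
    ring
  have I0 : Integrable (fun ξ => ‖𝓕 f ξ‖ ^ 2) := by
    have := (𝓕 f).memLp 2 (volume : Measure E3)
    exact (memLp_two_iff_integrable_sq_norm this.1).1 this
  have I1 : ∀ i : Fin 3, Integrable (fun ξ : E3 => 4 * π ^ 2 * ξ i ^ 2 * ‖𝓕 f ξ‖ ^ 2) := by
    intro i
    have := (𝓕 (∂_{(EuclideanSpace.single i (1:ℝ) : E3)} f)).memLp 2 (volume : Measure E3)
    have := (memLp_two_iff_integrable_sq_norm this.1).1 this
    simpa only [hF] using this
  have hsum : ∀ ξ : E3, ∑ i, 4 * π ^ 2 * ξ i ^ 2 * ‖𝓕 f ξ‖ ^ 2 =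
      4 * π ^ 2 * (‖ξ‖ ^ 2 * ‖𝓕 f ξ‖ ^ 2) := by
    intro ξ
    rw [EuclideanSpace.norm_sq_eq, Finset.sum_mul, Finset.mul_sum]
    refine Finset.sum_congr rfl fun i _ => ?_
    simp; ring
  have Ipd : ∀ i : Fin 3, Integrable (fun x => pd v i x ^ 2) := by
    intro i
    have := (∂_{(EuclideanSpace.single i (1:ℝ) : E3)} f).memLp 2 (volume : Measure E3)
    have := (memLp_two_iff_integrable_sq_norm this.1).1 this
    simpa [hd] using this
  have I2 : Integrable (fun ξ : E3 => ‖ξ‖ ^ 2 * ‖𝓕 f ξ‖ ^ 2) := by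
    have h := integrable_finsetSum Finset.univ (fun i _ => I1 i)
    simp only [hsum] at h
    have h' := h.const_mul (4 * π ^ 2)⁻¹
    refine h'.congr (Filter.Eventually.of_forall fun x => ?_)
    have : (4 * π ^ 2) ≠ 0 := by positivity
    simp only
    rw [inv_mul_cancel_left₀ this]
  have P2 : ∫ x, ∑ i, pd v i x ^ 2 = 4 * π ^ 2 * ∫ ξ : E3, ‖ξ‖ ^ 2 * ‖𝓕 f ξ‖ ^ 2 := by
    rw [integral_finsetSum _ (fun i _ => Ipd i), ← integral_const_mul]
    simp_rw [← hsum]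
    rw [integral_finsetSum _ (fun i _ => I1 i)]
    refine Finset.sum_congr rfl fun i _ => ?_
    rw [← P1]
    simp_rw [hF]
  have hb : ∀ ξ, ‖𝓕 f ξ‖ ^ 2 ≤ V * ∫ x, v x ^ 2 := by
    intro ξ
    have h1 : ‖𝓕 f ξ‖ ≤ ∫ x, |v x| := by
      rw [fourier_coe, Real.fourier_eq]
      refine (norm_integral_le_integral_norm _).trans (le_of_eq ?_)
      simp [hfx]
    calc ‖𝓕 f ξ‖ ^ 2 ≤ (∫ x, |v x|) ^ 2 := by gcongr
      _ ≤ _ := l1_l2 v hv.continuous hc V hV hs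
  obtain ⟨J1, J2⟩ := int_bathtub R hR
  have key : ∫ ξ : E3, (R ^ 2 * ‖𝓕 f ξ‖ ^ 2 - ‖ξ‖ ^ 2 * ‖𝓕 f ξ‖ ^ 2) ≤
      ∫ ξ : E3, max (R ^ 2 - ‖ξ‖ ^ 2) 0 * (V * ∫ x, v x ^ 2) := by
    apply integral_mono ((I0.const_mul _).sub I2) (J1.mul_const _)
    intro ξ
    simp only
    calc R ^ 2 * ‖𝓕 f ξ‖ ^ 2 - ‖ξ‖ ^ 2 * ‖𝓕 f ξ‖ ^ 2 = (R ^ 2 - ‖ξ‖ ^ 2) * ‖𝓕 f ξ‖ ^ 2 := by ring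
      _ ≤ max (R ^ 2 - ‖ξ‖ ^ 2) 0 * ‖𝓕 f ξ‖ ^ 2 := by gcongr; exact le_max_left _ _
      _ ≤ _ := by gcongr; exact hb ξ
  rw [integral_sub (I0.const_mul _) I2, integral_const_mul, integral_mul_const, J2, P0] at key
  rw [P2]
  have : 0 < 4 * π ^ 2 := by positivity
  have h2 : R ^ 2 * (1 - V * (8 * π / 15) * R ^ 3) * ∫ x, v x ^ 2 ≤
    ∫ ξ : E3, ‖ξ‖ ^ 2 * ‖𝓕 f ξ‖ ^ 2 := by nlinarith
  calc _ = 4 * π ^ 2 * (R ^ 2 * (1 - V * (8 * π / 15) * R ^ 3) * ∫ x, v x ^ 2) := by ring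
    _ ≤ _ := by gcongr

lemma inward_shift (Ω : Set E3) (hopen : IsOpen Ω) (hbd : HasCkBoundary ⊤ Ω) (x : E3)
    (hx : x ∈ closure Ω) : ∃ (n : E3) (r s0 : ℝ), 0 < r ∧ 0 < s0 ∧
      ∀ y ∈ closure Ω, y ∈ Metric.ball x r → ∀ s, 0 < s → s < s0 → y + s • n ∈ Ω := by
  by_cases hxO : x ∈ Ω
  · obtain ⟨r, hr, hb⟩ := Metric.isOpen_iff.1 hopen x hxO
    exact ⟨0, r, 1, hr, one_pos, fun y _ hy s _ _ => by simpa using hb hy⟩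
  · have hxf : x ∈ frontier Ω := by
      rw [hopen.frontier_eq]; exact ⟨hx, hxO⟩
    obtain ⟨U, φ, hU, hxU, hφ, hdφ, h1, h2⟩ := hbd x hxf
    have hcl : ∀ y ∈ closure Ω, y ∈ U → φ y ≤ 0 := by
      intro y hy hyU
      by_cases hyO : y ∈ Ω
      · have : y ∈ Ω ∩ U := ⟨hyO, hyU⟩
        rw [h1] at this
        exact this.2.le
      · have : y ∈ frontier Ω ∩ U := ⟨by rw [hopen.frontier_eq]; exact ⟨hy, hyO⟩, hyU⟩
        rw [h2] at this
        exact this.2.le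
    obtain ⟨n, hn⟩ : ∃ n : E3, fderiv ℝ φ x n < 0 := by
      have := hdφ x hxU
      obtain ⟨w, hw⟩ : ∃ w, fderiv ℝ φ x w ≠ 0 := by
        by_contra! hc
        exact this (ContinuousLinearMap.ext hc)
      rcases lt_or_gt_of_ne hw with h | h
      · exact ⟨w, h⟩
      · exact ⟨-w, by simpa using h⟩
    have hcont : ContinuousOn (fun y => fderiv ℝ φ y n) U :=
      (hφ.continuousOn_fderiv_of_isOpen hU (by simp)).clm_apply continuousOn_const
    have hev : ∀ᶠ y in 𝓝 x, y ∈ U ∧ fderiv ℝ φ y n < 0 :=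
      Filter.Eventually.and (hU.mem_nhds hxU)
        ((hcont.continuousAt (hU.mem_nhds hxU)).eventually_lt continuousAt_const hn)
    obtain ⟨r, hr, hb⟩ := Metric.eventually_nhds_iff_ball.1 hev
    refine ⟨n, r / 2, r / 2 / (‖n‖ + 1), by positivity, by positivity, ?_⟩
    intro y hy hyb s hs hs'
    have hline : ∀ t ∈ Set.Icc 0 s, y + t • n ∈ Metric.ball x r := by
      intro t ht
      have h3 : t * ‖n‖ < r / 2 := by
        have : s * (‖n‖ + 1) < r / 2 := by rwa [lt_div_iff₀ (by positivity)] at hs'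
        nlinarith [ht.1, ht.2, norm_nonneg n]
      rw [Metric.mem_ball] at hyb ⊢
      calc dist (y + t • n) x ≤ dist (y + t • n) y + dist y x := dist_triangle _ _ _
        _ = t * ‖n‖ + dist y x := by simp [norm_smul, abs_of_nonneg ht.1]
        _ < r := by linarith
    have hder : ∀ t ∈ Set.Icc 0 s, HasDerivAt (fun t : ℝ => φ (y + t • n))
        (fderiv ℝ φ (y + t • n) n) t := by
      intro t ht
      have hU' := (hb _ (hline t ht)).1
      have hd : DifferentiableAt ℝ φ (y + t • n) :=
        (hφ.contDiffAt (hU.mem_nhds hU')).differentiableAt (by simp)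
      have hl : HasDerivAt (fun t : ℝ => y + t • n) n t := by
        simpa using ((hasDerivAt_id t).smul_const n).const_add y
      exact hd.hasFDerivAt.comp_hasDerivAt t hl
    have hanti : StrictAntiOn (fun t : ℝ => φ (y + t • n)) (Set.Icc 0 s) := by
      apply strictAntiOn_of_deriv_neg (convex_Icc 0 s)
      · exact fun t ht => (hder t ht).continuousAt.continuousWithinAt
      · intro t ht
        rw [interior_Icc] at ht
        have ht' := Set.Ioo_subset_Icc_self ht
        rw [(hder t ht').deriv]
        exact (hb _ (hline t ht')).2
    have h5 : φ (y + s • n) < φ y := by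
      have := hanti (Set.left_mem_Icc.2 hs.le) (Set.right_mem_Icc.2 hs.le) hs
      simpa using this
    have hyU : y ∈ U := by
      have := (hb _ (hline 0 (Set.left_mem_Icc.2 hs.le))).1
      simpa using this
    have h6 := hcl y hy hyU
    have : y + s • n ∈ Ω ∩ U := by
      rw [h1]
      exact ⟨(hb _ (hline s (Set.right_mem_Icc.2 hs.le))).1, by linarith⟩
    exact this.1

open scoped Pointwise in
lemma frontier_null (Ω : Set E3) (hopen : IsOpen Ω) (hbd : HasCkBoundary ⊤ Ω) :
    volume (frontier Ω) = 0 := by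
  apply measure_null_of_locally_null
  intro x hx
  obtain ⟨n, r, s0, hr, hs0, h⟩ := inward_shift Ω hopen hbd x (frontier_subset_closure hx)
  refine ⟨frontier Ω ∩ Metric.ball x r,
    inter_mem_nhdsWithin _ (Metric.ball_mem_nhds x hr), ?_⟩
  have hnot : ∀ y ∈ frontier Ω, y ∉ Ω := by
    intro y hy
    rw [hopen.frontier_eq] at hy
    exact hy.2
  set u : ℕ → E3 := fun k => (s0 / (2 * (k + 1)) : ℝ) • n with hu
  have hstep : ∀ k l : ℕ, k < l → s0 / (2 * ((l:ℝ) + 1)) < s0 / (2 * ((k:ℝ) + 1)) := by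
    intro k l hkl
    have : (k : ℝ) < l := by exact_mod_cast hkl
    gcongr
  have hlt : ∀ k : ℕ, s0 / (2 * ((k:ℝ) + 1)) < s0 := by
    intro k
    rw [div_lt_iff₀ (by positivity)]
    nlinarith [(Nat.cast_nonneg k : (0:ℝ) ≤ k)]
  have hdis : ∀ k l : ℕ, k < l → Disjoint (({u k} : Set E3) + (frontier Ω ∩ Metric.ball x r))
      (({u l} : Set E3) + (frontier Ω ∩ Metric.ball x r)) := by
    intro k l hkl
    rw [Set.disjoint_left]
    rintro z hz1 hz2
    rw [Set.singleton_add] at hz1 hz2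
    obtain ⟨y, hy, rfl⟩ := hz1
    obtain ⟨y', hy', he⟩ := hz2
    simp only [hu] at he
    have h1 : y' = y + (s0 / (2 * ((k:ℝ) + 1)) - s0 / (2 * ((l:ℝ) + 1))) • n := by
      rw [sub_smul]
      have : y' = (s0 / (2 * ((k:ℝ) + 1))) • n + y - (s0 / (2 * ((l:ℝ) + 1))) • n := by
        rw [← he]; abel
      rw [this]; abel
    apply hnot y' hy'.1
    rw [h1]
    have hp : 0 < s0 / (2 * ((l:ℝ) + 1)) := by positivity
    exact h y (frontier_subset_closure hy.1) hy.2 _ (by linarith [hstep k l hkl])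
      (by linarith [hlt k])
  apply Measure.addHaar_eq_zero_of_disjoint_translates volume u
  · rw [isBounded_iff_forall_norm_le]
    refine ⟨s0 * ‖n‖, ?_⟩
    rintro _ ⟨k, rfl⟩
    simp only [hu, norm_smul]
    have hp : 0 < s0 / (2 * ((k:ℝ) + 1)) := by positivity
    rw [Real.norm_of_nonneg hp.le]
    exact mul_le_mul_of_nonneg_right (hlt k).le (norm_nonneg _)
  · intro k l hkl
    rcases lt_or_gt_of_ne hkl with h' | h'
    · exact hdis k l h'
    · exact (hdis l k h').symm
  · exact isClosed_frontier.measurableSet.inter measurableSet_ball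

lemma pd_mul {p q : E3 → ℝ} {x : E3} (hp : DifferentiableAt ℝ p x) (hq : DifferentiableAt ℝ q x)
    (i : Fin 3) : pd (fun y => p y * q y) i x = pd p i x * q x + p x * pd q i x := by
  unfold pd
  rw [fderiv_fun_mul hp hq]
  simp
  ring

lemma pd_congr {p q : E3 → ℝ} {x : E3} (h : p =ᶠ[𝓝 x] q) (i : Fin 3) : pd p i x = pd q i x := by
  unfold pd
  rw [h.fderiv_eq]

lemma pd_const (c : ℝ) (i : Fin 3) (x : E3) : pd (fun _ => c) i x = 0 := by
  simp [pd]

lemma pd_sum {ι : Type*} (s : Finset ι) {p : ι → E3 → ℝ} {x : E3}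
    (hp : ∀ k ∈ s, DifferentiableAt ℝ (p k) x) (i : Fin 3) :
    pd (fun y => ∑ k ∈ s, p k y) i x = ∑ k ∈ s, pd (p k) i x := by
  unfold pd
  rw [fderiv_fun_sum hp]
  simp

lemma pd_shift (p : E3 → ℝ) (n x : E3) (i : Fin 3) : pd (fun y => p (y + n)) i x = pd p i (x + n) := by
  unfold pd
  rw [fderiv_comp_add_right]

set_option maxHeartbeats 4000000 in
open scoped Manifold in
lemma field_approx (Ω : Set E3) (hopen : IsOpen Ω) (hbdd : Bornology.IsBounded Ω)
    (hbd : HasCkBoundary ⊤ Ω) (a : E3 → E3) (ha : ContDiffOn ℝ 1 a (closure Ω))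
    (hdiv : ∀ x ∈ Ω, (∑ i, pd (fun y => a y i) i x) = 0) (τ : ℝ) (hτ : 0 < τ) :
    ∃ b : Fin 3 → E3 → ℝ, (∀ i, ContDiff ℝ 1 (b i)) ∧
      (∀ y ∈ closure Ω, ∀ i, |b i y - a y i| ≤ τ) ∧
      ∀ y ∈ closure Ω, |∑ i, pd (b i) i y| ≤ τ := by
  have hQc : IsCompact (closure Ω) := hbdd.isCompact_closure
  choose! n r s0 hr hs0 hsh using inward_shift Ω hopen hbd
  obtain ⟨t, htQ, htc⟩ := hQc.elim_nhds_subcover (fun x => Metric.ball x (r x))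
    (fun x hx => Metric.ball_mem_nhds x (hr x hx))
  obtain ⟨χ, hχ⟩ := SmoothPartitionOfUnity.exists_isSubordinate 𝓘(ℝ, E3)
    (isClosed_closure (s := Ω)) (fun i : t => Metric.ball (i : E3) (r i))
    (fun i => Metric.isOpen_ball) (by
      intro x hx
      have := htc hx
      simp only [Set.mem_iUnion] at this ⊢
      obtain ⟨i, hi, hxi⟩ := this
      exact ⟨⟨i, hi⟩, hxi⟩)
  have hχs : ∀ i, ContDiff ℝ ∞ (χ i) := fun i => (χ i).contMDiff.contDiff
  have hχ1 : ∀ x ∈ closure Ω, ∑ i, χ i x = 1 := by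
    intro x hx
    rw [← finsum_eq_sum_of_fintype]
    exact χ.sum_eq_one hx
  have hχ0 : ∀ i x, 0 ≤ χ i x := fun i x => χ.nonneg i x
  have hajc : ∀ j : Fin 3, ContinuousOn (fun y => a y j) (closure Ω) := fun j =>
    (EuclideanSpace.proj (𝕜 := ℝ) j).continuous.comp_continuousOn ha.continuousOn
  have haj : ∀ j : Fin 3, ∀ y ∈ Ω, ContDiffAt ℝ 1 (fun y => a y j) y := fun j y hy =>
    (EuclideanSpace.proj (𝕜 := ℝ) j : E3 →L[ℝ] ℝ).contDiff.contDiffAt.comp y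
      (ha.contDiffAt (Filter.mem_of_superset (hopen.mem_nhds hy) subset_closure))
  -- bound on gradients
  obtain ⟨G, hG0, hG⟩ : ∃ G : ℝ, 0 < G ∧ ∀ i : t, ∀ j : Fin 3, ∀ y ∈ closure Ω, |pd (χ i) j y| ≤ G := by
    have h1 : ∀ i : t, ∀ j : Fin 3, ∃ G : ℝ, ∀ y ∈ closure Ω, |pd (χ i) j y| ≤ G := by
      intro i j
      have hc : Continuous (fun y => pd (χ i) j y) :=
        ((hχs i).continuous_fderiv (by simp)).clm_apply continuous_const
      obtain ⟨G, hG⟩ := hQc.exists_bound_of_continuousOn hc.continuousOn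
      exact ⟨G, hG⟩
    choose G hG using h1
    refine ⟨1 + ∑ i, ∑ j, |G i j|, by positivity, fun i j y hy => ?_⟩
    have h2 : |G i j| ≤ ∑ j, |G i j| :=
      Finset.single_le_sum (f := fun j => |G i j|) (fun _ _ => abs_nonneg _) (Finset.mem_univ j)
    have h3 : ∑ j, |G i j| ≤ ∑ i, ∑ j, |G i j| :=
      Finset.single_le_sum (f := fun i => ∑ j, |G i j|)
        (fun _ _ => Finset.sum_nonneg fun _ _ => abs_nonneg _) (Finset.mem_univ i)
    linarith [hG i j y hy, le_abs_self (G i j)]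
  set δ : ℝ := τ / (1 + t.card * (3 * G)) with hδ
  have hden : 0 < 1 + t.card * (3 * G) := by positivity
  have hδ0 : 0 < δ := by positivity
  have hδτ : δ ≤ τ := by
    rw [hδ, div_le_iff₀ hden]
    have : 0 ≤ (t.card : ℝ) * (3 * G) := by positivity
    nlinarith
  have hδ2 : t.card * (3 * (G * δ)) ≤ τ := by
    have : δ * (1 + t.card * (3 * G)) = τ := by rw [hδ]; field_simp
    nlinarith
  -- uniform continuity
  have huc : ∀ j : Fin 3, UniformContinuousOn (fun y => a y j) (closure Ω) := fun j =>
    hQc.uniformContinuousOn_of_continuous (hajc j)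
  have huc' : ∀ j : Fin 3, ∃ η > 0, ∀ x ∈ closure Ω, ∀ y ∈ closure Ω, dist x y < η →
      |a x j - a y j| ≤ δ := by
    intro j
    obtain ⟨η, hη, h⟩ := Metric.uniformContinuousOn_iff.1 (huc j) δ hδ0
    exact ⟨η, hη, fun x hx y hy hxy => (h x hx y hy hxy).le⟩
  choose η hη hηa using huc'
  -- choose s
  obtain ⟨s, hs, hss0, hsη⟩ : ∃ s : ℝ, 0 < s ∧ (∀ i : t, s < s0 i) ∧
      ∀ (i : t) (j : Fin 3), s * ‖n i‖ < η j := by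
    have e1 : ∀ᶠ s : ℝ in 𝓝[>] 0, ∀ i : t, s < s0 i := by
      rw [Filter.eventually_all]
      intro i
      exact nhdsWithin_le_nhds (eventually_lt_nhds (hs0 i (htQ i i.2)))
    have e2 : ∀ᶠ s : ℝ in 𝓝[>] 0, ∀ (i : t) (j : Fin 3), s * ‖n i‖ < η j := by
      rw [Filter.eventually_all]
      intro i
      rw [Filter.eventually_all]
      intro j
      apply nhdsWithin_le_nhds
      have : ContinuousAt (fun s : ℝ => s * ‖n i‖) 0 := by fun_prop
      exact this.eventually_lt continuousAt_const (by simpa using hη j)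
    obtain ⟨s, h1, h2, h3⟩ := (e1.and (e2.and self_mem_nhdsWithin)).exists
    exact ⟨s, h3, h1, h2⟩
  have hin : ∀ (i : t) y, y ∈ closure Ω → y ∈ tsupport (χ i) → y + s • n i ∈ Ω := by
    intro i y hy hyi
    exact hsh i (htQ i i.2) y hy (hχ i hyi) s hs (hss0 i)
  have hclose : ∀ (i : t) (j : Fin 3) y, y ∈ closure Ω → y ∈ tsupport (χ i) →
      |a (y + s • n i) j - a y j| ≤ δ := by
    intro i j y hy hyi
    apply hηa j _ (subset_closure (hin i y hy hyi)) _ hy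
    rw [dist_eq_norm]
    simpa [norm_smul, abs_of_pos hs] using hsη i j
  set c : Fin 3 → E3 → ℝ := fun j y => ∑ i : t, χ i y * a (y + s • n i) j with hc
  have hcC : ∀ j y, y ∈ closure Ω → ∀ i : t,
      ContDiffAt ℝ 1 (fun y => χ i y * a (y + s • n i) j) y := by
    intro j y hy i
    by_cases hyi : y ∈ tsupport (χ i)
    · apply ((hχs i).of_le (by simp)).contDiffAt.mul
      have h1 := haj j _ (hin i y hy hyi)
      exact ContDiffAt.comp (g := fun y => a y j) (f := fun y => y + s • n i) y h1
        (contDiffAt_id.add contDiffAt_const)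
    · have : (fun y => χ i y * a (y + s • n i) j) =ᶠ[𝓝 y] fun _ => 0 := by
        have := notMem_tsupport_iff_eventuallyEq.1 hyi
        filter_upwards [this] with z hz
        rw [hz]; simp
      exact contDiffAt_const.congr_of_eventuallyEq this
  have hcC' : ∀ j y, y ∈ closure Ω → ContDiffAt ℝ 1 (c j) y := fun j y hy =>
    ContDiffAt.sum fun i _ => hcC j y hy i
  have hca : ∀ y ∈ closure Ω, ∀ j, |c j y - a y j| ≤ δ := by
    intro y hy j
    have h1 : c j y - a y j = ∑ i : t, χ i y * (a (y + s • n i) j - a y j) := by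
      simp only [mul_sub, Finset.sum_sub_distrib, ← Finset.sum_mul, hχ1 y hy, one_mul, hc]
    rw [h1]
    calc |∑ i : t, χ i y * (a (y + s • n i) j - a y j)|
        ≤ ∑ i : t, |χ i y * (a (y + s • n i) j - a y j)| := Finset.abs_sum_le_sum_abs _ _
      _ ≤ ∑ i : t, χ i y * δ := by
        refine Finset.sum_le_sum fun i _ => ?_
        by_cases hyi : y ∈ tsupport (χ i)
        · rw [abs_mul, abs_of_nonneg (hχ0 i y)]
          exact mul_le_mul_of_nonneg_left (hclose i j y hy hyi) (hχ0 i y)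
        · rw [image_eq_zero_of_notMem_tsupport hyi]; simp
      _ = δ := by rw [← Finset.sum_mul, hχ1 y hy, one_mul]
  have hcdiv : ∀ y ∈ Ω, |∑ j, pd (c j) j y| ≤ τ := by
    intro y hyO
    have hy := subset_closure hyO
    have h0 : ∀ j, ∑ i : t, pd (χ i) j y = 0 := by
      intro j
      rw [← pd_sum Finset.univ (fun i _ => (hχs i).differentiable (by simp) y)]
      rw [← pd_const 1 j y]
      apply pd_congr
      filter_upwards [hopen.mem_nhds hyO] with z hz
      exact hχ1 z (subset_closure hz)
    have h1 : ∀ j, pd (c j) j y = ∑ i : t,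
        (pd (χ i) j y * (a (y + s • n i) j - a y j) + χ i y * pd (fun z => a z j) j (y + s • n i)) := by
      intro j
      have : pd (c j) j y = ∑ i : t,
        (pd (χ i) j y * a (y + s • n i) j + χ i y * pd (fun z => a z j) j (y + s • n i)) := by
        rw [hc]
        simp only
        rw [pd_sum Finset.univ (fun i _ => (hcC j y hy i).differentiableAt (by simp))]
        refine Finset.sum_congr rfl fun i _ => ?_
        by_cases hyi : y ∈ tsupport (χ i)
        · have h1 := haj j _ (hin i y hy hyi)
          have h2 : DifferentiableAt ℝ (fun y => a (y + s • n i) j) y :=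
            (ContDiffAt.comp (g := fun y => a y j) (f := fun y => y + s • n i) y h1
              (contDiffAt_id.add contDiffAt_const)).differentiableAt (by simp)
          rw [pd_mul ((hχs i).differentiable (by simp) y) h2]
          rw [pd_shift (fun z => a z j)]
        · have e := notMem_tsupport_iff_eventuallyEq.1 hyi
          have e0 : (fun y => χ i y * a (y + s • n i) j) =ᶠ[𝓝 y] fun _ => 0 := by
            filter_upwards [e] with z hz
            rw [hz]; simp
          have e1 : (χ i : E3 → ℝ) =ᶠ[𝓝 y] fun _ => 0 := e
          rw [pd_congr e0, pd_congr e1, pd_const, image_eq_zero_of_notMem_tsupport hyi]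
          simp
      rw [this]
      have h2 : ∑ i : t, pd (χ i) j y * a y j = 0 := by
        rw [← Finset.sum_mul, h0, zero_mul]
      rw [← sub_zero (∑ i : t, _), ← h2, ← Finset.sum_sub_distrib]
      refine Finset.sum_congr rfl fun i _ => ?_
      ring
    have h3 : ∑ j, pd (c j) j y = ∑ i : t, ∑ j, pd (χ i) j y * (a (y + s • n i) j - a y j) := by
      simp_rw [h1]
      rw [Finset.sum_comm]
      refine Finset.sum_congr rfl fun i _ => ?_
      rw [Finset.sum_add_distrib, ← Finset.mul_sum]
      by_cases hyi : y ∈ tsupport (χ i)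
      · rw [hdiv _ (hin i y hy hyi)]; simp
      · rw [image_eq_zero_of_notMem_tsupport hyi]; simp
    rw [h3]
    calc |∑ i : t, ∑ j, pd (χ i) j y * (a (y + s • n i) j - a y j)|
        ≤ ∑ i : t, |∑ j, pd (χ i) j y * (a (y + s • n i) j - a y j)| :=
          Finset.abs_sum_le_sum_abs _ _
      _ ≤ ∑ i : t, 3 * (G * δ) := by
        refine Finset.sum_le_sum fun i _ => ?_
        calc |∑ j, pd (χ i) j y * (a (y + s • n i) j - a y j)|
            ≤ ∑ j, |pd (χ i) j y * (a (y + s • n i) j - a y j)| := Finset.abs_sum_le_sum_abs _ _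
          _ ≤ ∑ j : Fin 3, G * δ := by
            refine Finset.sum_le_sum fun j _ => ?_
            rw [abs_mul]
            by_cases hyi : y ∈ tsupport (χ i)
            · exact mul_le_mul (hG i j y hy) (hclose i j y hy hyi) (abs_nonneg _) hG0.le
            · have e1 : (χ i : E3 → ℝ) =ᶠ[𝓝 y] fun _ => 0 :=
                notMem_tsupport_iff_eventuallyEq.1 hyi
              rw [pd_congr e1, pd_const]; simp; positivity
          _ = 3 * (G * δ) := by simp
      _ = t.card * (3 * (G * δ)) := by simp
      _ ≤ τ := hδ2
  -- globalize
  set O : Set E3 := {y | ∀ᶠ z in 𝓝 y, ∀ j, ContDiffAt ℝ 1 (c j) z} with hO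
  have hOo : IsOpen O := isOpen_setOfPred_eventually_nhds
  have hQO : closure Ω ⊆ O := by
    intro y hy
    rw [hO, Set.mem_ofPred_eq, Filter.eventually_all]
    intro j
    exact (hcC' j y hy).eventually (by simp)
  obtain ⟨ζ, hζ0, hζ1, -⟩ := exists_contMDiffMap_zero_one_nhds_of_isClosed (n := (1 : ℕ∞)) 𝓘(ℝ, E3)
    hOo.isClosed_compl isClosed_closure (Set.disjoint_left.2 fun y hy hy' => hy (hQO hy'))
  have hζs : ContDiff ℝ 1 (ζ : E3 → ℝ) := ζ.contMDiff.contDiff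
  have hbC : ∀ j, ContDiff ℝ 1 (fun y => ζ y * c j y) := by
    intro j
    rw [contDiff_iff_contDiffAt]
    intro y
    by_cases hyO : y ∈ O
    · exact hζs.contDiffAt.mul (hyO.self_of_nhds j)
    · have : (fun y => ζ y * c j y) =ᶠ[𝓝 y] fun _ => 0 := by
        filter_upwards [eventually_nhdsSet_iff_forall.1 hζ0 y hyO] with z hz
        rw [hz, zero_mul]
      exact contDiffAt_const.congr_of_eventuallyEq this
  have hbe : ∀ y ∈ closure Ω, ∀ j, (fun y => ζ y * c j y) =ᶠ[𝓝 y] c j := by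
    intro y hy j
    filter_upwards [eventually_nhdsSet_iff_forall.1 hζ1 y hy] with z hz
    rw [hz, one_mul]
  refine ⟨fun j y => ζ y * c j y, hbC, fun y hy j => ?_, ?_⟩
  · have := (hbe y hy j).self_of_nhds
    simp only at this
    show |ζ y * c j y - _| ≤ _
    rw [this]
    exact (hca y hy j).trans hδτ
  · have hcl : IsClosed {y | |∑ i, pd (fun y => ζ y * c i y) i y| ≤ τ} := by
      apply isClosed_le _ continuous_const
      apply Continuous.abs
      apply continuous_finsetSum
      intro i _
      exact ((hbC i).continuous_fderiv (by simp)).clm_apply continuous_const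
    apply closure_minimal _ hcl
    intro y hy
    have : ∀ i, pd (fun y => ζ y * c i y) i y = pd (c i) i y := fun i =>
      pd_congr (hbe y (subset_closure hy) i) i
    simp only [Set.mem_ofPred_eq, this]
    exact hcdiv y hy

lemma pd_smooth {v : E3 → ℝ} (hv : ContDiff ℝ ∞ v) (i : Fin 3) :
    ContDiff ℝ ∞ (fun x => pd v i x) := by
  unfold pd
  exact ContDiff.clm_apply (hv.fderiv_right (m := ∞) (by simp)) contDiff_const

lemma pd_compact {v : E3 → ℝ} (hv : HasCompactSupport v) (i : Fin 3) :
    HasCompactSupport (fun x => pd v i x) := by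
  unfold pd
  exact HasCompactSupport.fderiv_apply ℝ hv _

lemma smooth_int {v : E3 → ℝ} (hv : Continuous v) (hc : HasCompactSupport v) :
    Integrable v := hv.integrable_of_hasCompactSupport hc

lemma conv_smooth (μ : Measure E3) {α w : E3 → ℝ} (hα : LocallyIntegrable α μ)
    (hw : ContDiff ℝ ∞ w) (hc : HasCompactSupport w) :
    ContDiff ℝ ∞ (fun x => ∫ t, α t * w (x - t) ∂μ) :=
  HasCompactSupport.contDiff_convolution_right (ContinuousLinearMap.mul ℝ ℝ) (n := ⊤) hc hα hw

lemma conv_pd {ρ w : E3 → ℝ} (hρ : LocallyIntegrable ρ) (hw : ContDiff ℝ ∞ w)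
    (hc : HasCompactSupport w) (i : Fin 3) (x : E3) :
    pd (fun x => ∫ t, ρ t * w (x - t)) i x = ∫ t, ρ t * pd w i (x - t) := by
  have h1 : ContDiff ℝ 1 w := hw.of_le (by simp)
  have := HasCompactSupport.hasFDerivAt_convolution_right (ContinuousLinearMap.mul ℝ ℝ)
    (μ := volume) hc hρ h1 x
  have h2 : pd (fun x => ∫ t, ρ t * w (x - t)) i x =
    ((convolution ρ (fderiv ℝ w) (ContinuousLinearMap.precompR E3 (ContinuousLinearMap.mul ℝ ℝ)) volume) x) (EuclideanSpace.single i 1) := by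
    unfold pd
    rw [← this.fderiv]
    rfl
  rw [h2]
  unfold convolution
  rw [ContinuousLinearMap.integral_apply]
  · rfl
  · exact (hc.fderiv ℝ).convolutionExists_right _ hρ (h1.continuous_fderiv (by simp)) x

lemma fub (μ : Measure E3) [IsFiniteMeasure μ] {α ρ w : E3 → ℝ} (hα : Integrable α μ)
    (hρ : Continuous ρ) (hρc : HasCompactSupport ρ) (hρe : ∀ x, ρ (-x) = ρ x)
    (hw : Continuous w) (hwc : HasCompactSupport w) :
    ∫ y, α y * (∫ t, ρ t * w (y - t)) ∂μ = ∫ x, w x * (∫ q, α q * ρ (x - q) ∂μ) := by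
  have h1 : ∀ y, ∫ t, ρ t * w (y - t) = ∫ x, ρ (x - y) * w x := by
    intro y
    rw [← integral_sub_left_eq_self (fun x => ρ (x - y) * w x) volume y]
    congr 1
    ext t
    rw [← hρe t]
    congr 2
    abel
  simp_rw [h1, ← integral_const_mul]
  rw [integral_integral_swap]
  · congr 1
    ext x
    congr 1
    ext y
    ring
  · obtain ⟨C, hC⟩ := hρc.exists_bound_of_continuous hρ
    have : Integrable (fun z : E3 × E3 => α z.1 * w z.2) (μ.prod volume) :=
      hα.mul_prod (smooth_int hw hwc)
    refine ((this.bdd_mul (c := C) (f := fun z : E3 × E3 => ρ (z.2 - z.1)) ?_ ?_)).congr ?_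
    · exact (hρ.comp (continuous_snd.sub continuous_fst)).aestronglyMeasurable
    · exact Eventually.of_forall fun z => hC _
    · refine Eventually.of_forall fun z => ?_
      simp [Function.uncurry]
      ring

lemma ibp {p q : E3 → ℝ} (hp : ContDiff ℝ 1 p) (hq : ContDiff ℝ 1 q) (hqc : HasCompactSupport q)
    (i : Fin 3) : ∫ x, p x * pd q i x = - ∫ x, pd p i x * q x := by
  unfold pd
  have cp : Continuous fun x => fderiv ℝ p x (EuclideanSpace.single i 1) :=
    (hp.continuous_fderiv (by simp)).clm_apply continuous_const
  have cq : Continuous fun x => fderiv ℝ q x (EuclideanSpace.single i 1) :=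
    (hq.continuous_fderiv (by simp)).clm_apply continuous_const
  apply integral_mul_fderiv_eq_neg_fderiv_mul_of_integrable
  · exact smooth_int (cp.mul hq.continuous) hqc.mul_left
  · exact smooth_int (hp.continuous.mul cq) (HasCompactSupport.fderiv_apply ℝ hqc _).mul_left
  · exact smooth_int (hp.continuous.mul hq.continuous) hqc.mul_left
  · exact fun x _ => hp.differentiable (by simp) x
  · exact fun x _ => hq.differentiable (by simp) x

lemma unif_near {Q : Set E3} (hQ : IsCompact Q) {F : E3 → ℝ} (hF : Continuous F) {τ : ℝ}
    (hτ : 0 < τ) : ∀ᶠ ε in 𝓝[>] (0:ℝ), ∀ q ∈ Q, ∀ x, dist x q ≤ ε → |F x - F q| ≤ τ := by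
  have := hQ.uniformContinuousAt_of_continuousAt F (fun a _ => hF.continuousAt)
    (Metric.dist_mem_uniformity hτ)
  obtain ⟨δ, hδ, h⟩ := Metric.mem_uniformity_dist.1 this
  filter_upwards [Ioo_mem_nhdsGT hδ] with ε hε q hq x hx
  have h3 : dist q x < δ := by rw [dist_comm]; exact hx.trans_lt hε.2
  have h2 := h h3 hq
  have h4 : dist (F q) (F x) < τ := h2
  rw [dist_comm, Real.dist_eq] at h4
  exact h4.le

lemma choose_eps (Ω : Set E3) (hopen : IsOpen Ω) (hbdd : Bornology.IsBounded Ω)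
    (hbd : HasCkBoundary ⊤ Ω) (V : ℝ) (hV : volume Ω < ENNReal.ofReal V)
    (b : Fin 3 → E3 → ℝ) (hb : ∀ i, ContDiff ℝ 1 (b i)) (τ : ℝ) (hτ : 0 < τ) :
    ∃ ε > 0, volume (Metric.cthickening ε (closure Ω)) ≤ ENNReal.ofReal V ∧
      (∀ q ∈ closure Ω, ∀ x, dist x q ≤ ε → ∀ i, |b i x - b i q| ≤ τ) ∧
      (∀ q ∈ closure Ω, ∀ x, dist x q ≤ ε → |(∑ i, pd (b i) i x) - ∑ i, pd (b i) i q| ≤ τ) := by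
  have hQ : IsCompact (closure Ω) := hbdd.isCompact_closure
  have hvQ : volume (closure Ω) < ENNReal.ofReal V := by
    rw [closure_eq_self_union_frontier]
    refine (measure_union_le _ _).trans_lt ?_
    rw [frontier_null Ω hopen hbd, add_zero]
    exact hV
  have e1 : ∀ᶠ ε in 𝓝[>] (0:ℝ), volume (Metric.cthickening ε (closure Ω)) < ENNReal.ofReal V :=
    ((tendsto_measure_cthickening_of_isCompact hQ).eventually (gt_mem_nhds hvQ)).filter_mono
      nhdsWithin_le_nhds
  have e2 : ∀ᶠ ε in 𝓝[>] (0:ℝ), ∀ i, ∀ q ∈ closure Ω, ∀ x, dist x q ≤ ε → |b i x - b i q| ≤ τ :=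
    eventually_all.2 fun i => unif_near hQ (hb i).continuous hτ
  have e3 := unif_near hQ (F := fun x => ∑ i, pd (b i) i x) (by
    apply continuous_finsetSum
    intro i _
    exact ((hb i).continuous_fderiv (by simp)).clm_apply continuous_const) hτ
  obtain ⟨ε, ⟨⟨h1, h2⟩, h3⟩, h4⟩ := (((e1.and e2).and e3).and self_mem_nhdsWithin).exists
  exact ⟨ε, h4, h1.le, fun q hq x hx i => h2 i q hq x hx, h3⟩

lemma dual_zero (Ω : Set E3) (hopen : IsOpen Ω) (hbdd : Bornology.IsBounded Ω)
    (hbd : HasCkBoundary ⊤ Ω) (a : E3 → E3) (ha : ContDiffOn ℝ 1 a (closure Ω))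
    (hdiv : ∀ x ∈ Ω, (∑ i, pd (fun y => a y i) i x) = 0) (d l V R : ℝ) (hl : 0 < l) (hd : 0 < d)
    (hV0 : 0 < V) (hR : 0 < R)
    (hV : volume Ω < ENNReal.ofReal V) (hc : l < d * (4*π^2*R^2*(1 - V*(8*π/15)*R^3)))
    (μ : Measure E3) [IsFiniteMeasure μ] (hμ : μ (closure Ω)ᶜ = 0)
    (h : ∀ φ : E3 → ℝ, ContDiff ℝ ∞ φ → (∀ x ∈ closure Ω, 0 ≤ φ x) →
      ∫ x, (-d * lap φ x + (∑ i, a x i * pd φ i x) - l * φ x) ∂μ ≤ 0) : μ = 0 := by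
  set c := 4*π^2*R^2*(1 - V*(8*π/15)*R^3) with hcdef
  have hQ : IsCompact (closure Ω) := hbdd.isCompact_closure
  have hc0 : 0 < c := by
    by_contra hcc
    push Not at hcc
    nlinarith
  obtain ⟨τ, hτ0, hτ⟩ : ∃ τ > 0, τ * (c + 4) < d * c - l := by
    refine ⟨(d * c - l) / (2 * (c + 4)), by apply div_pos <;> linarith, ?_⟩
    have : (d * c - l) / (2 * (c + 4)) * (c + 4) = (d * c - l) / 2 := by field_simp
    rw [this]; linarith
  have hτd : τ < d := by nlinarith
  obtain ⟨b, hb, hba, hbdiv⟩ := field_approx Ω hopen hbdd hbd a ha hdiv τ hτ0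
  obtain ⟨ε, hε, hεV, hεb, hεd⟩ := choose_eps Ω hopen hbdd hbd V hV b hb τ hτ0
  -- the mollifier
  let B : ContDiffBump (0 : E3) := ⟨ε/2, ε, by linarith, by linarith⟩
  obtain ⟨ρ, hρs, hρc, hρe, hρ0, hρp, hρz⟩ : ∃ ρ : E3 → ℝ, ContDiff ℝ ∞ ρ ∧ HasCompactSupport ρ ∧
      (∀ x, ρ (-x) = ρ x) ∧ (∀ x, 0 ≤ ρ x) ∧ ρ 0 ≠ 0 ∧ ∀ x, ε < ‖x‖ → ρ x = 0 := by
    refine ⟨B.normed volume, B.contDiff_normed (n := ⊤), B.hasCompactSupport_normed, B.normed_neg,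
      fun x => B.nonneg_normed x, ?_, fun x hx => ?_⟩
    · have : (0:E3) ∈ Function.support (B.normed volume) := by
        rw [B.support_normed_eq]
        exact Metric.mem_ball_self B.rOut_pos
      exact this
    by_contra hne
    have : x ∈ Function.support (B.normed volume) := hne
    rw [B.support_normed_eq] at this
    simp at this
    exact absurd this (not_lt.2 hx.le)
  have hρC : Continuous ρ := hρs.continuous
  have aeQ : ∀ᵐ q ∂μ, q ∈ closure Ω := by
    rw [ae_iff]; exact hμ
  have hμr : μ.restrict (closure Ω) = μ := by
    exact Measure.restrict_eq_self_of_ae_mem aeQ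
  have haI : ∀ i, Integrable (fun q => a q i) μ := by
    intro i
    have h1 : ContinuousOn (fun q => a q i) (closure Ω) := by
      have := ha.continuousOn
      fun_prop
    have := h1.integrableOn_compact (μ := μ) hQ
    rwa [IntegrableOn, hμr] at this
  have cI : ∀ {F : E3 → ℝ}, Continuous F → Integrable F μ := by
    intro F hF
    have := hF.continuousOn.integrableOn_compact (μ := μ) hQ
    rwa [IntegrableOn, hμr] at this
  have h1I : Integrable (fun _ : E3 => (1:ℝ)) μ := integrable_const _
  set v : E3 → ℝ := fun x => ∫ q, (1:ℝ) * ρ (x - q) ∂μ with hv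
  set A : Fin 3 → E3 → ℝ := fun i x => ∫ q, a q i * ρ (x - q) ∂μ with hA
  have hvs : ContDiff ℝ ∞ v := conv_smooth μ h1I.locallyIntegrable hρs hρc
  have hAs : ∀ i, ContDiff ℝ ∞ (A i) := fun i => conv_smooth μ (haI i).locallyIntegrable hρs hρc
  have hv0 : ∀ x, 0 ≤ v x := fun x => integral_nonneg fun q => by simpa using hρ0 _
  have hvz : ∀ x, (∀ q ∈ closure Ω, ε < dist x q) → v x = 0 := by
    intro x hx
    apply integral_eq_zero_of_ae
    filter_upwards [aeQ] with q hq
    simp [hρz (x - q) (by rw [← dist_eq_norm]; exact hx q hq)]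
  have hth : ∀ x, v x ≠ 0 → ∃ q ∈ closure Ω, dist x q ≤ ε := by
    intro x hx
    by_contra hcon
    push Not at hcon
    exact hx (hvz x hcon)
  have hts : tsupport v ⊆ Metric.cthickening ε (closure Ω) := by
    apply closure_minimal _ Metric.isClosed_cthickening
    intro x hx
    obtain ⟨q, hq, hxq⟩ := hth x hx
    exact Metric.mem_cthickening_of_dist_le x q ε _ hq hxq
  have hvc : HasCompactSupport v := hQ.cthickening.of_isClosed_subset (isClosed_tsupport v) hts
  have hLY := liyau v hvs hvc V hV0 ((measure_mono hts).trans hεV) R hR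
  rw [← hcdef] at hLY
  -- closeness
  have hAb : ∀ i x, |A i x - b i x * v x| ≤ 2 * τ * v x := by
    intro i x
    have hi1 : Integrable (fun q => a q i * ρ (x - q)) μ := by
      obtain ⟨C, hC⟩ := hρc.exists_bound_of_continuous hρC
      exact (haI i).mul_bdd (c := C) (hρC.comp (continuous_const.sub continuous_id)).aestronglyMeasurable
        (Eventually.of_forall fun q => hC _)
    have hi2 : Integrable (fun q => ρ (x - q)) μ := cI (by fun_prop)
    have e1 : A i x - b i x * v x = ∫ q, (a q i - b i x) * ρ (x - q) ∂μ := by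
      simp only [hA, hv, one_mul]
      rw [← integral_const_mul, ← integral_sub hi1 (hi2.const_mul _)]
      congr 1; ext q; ring
    have e2 : 2 * τ * v x = ∫ q, 2 * τ * ρ (x - q) ∂μ := by
      simp only [hv, one_mul]
      rw [integral_const_mul]
    rw [e1, e2, ← Real.norm_eq_abs]
    apply norm_integral_le_of_norm_le (hi2.const_mul _)
    filter_upwards [aeQ] with q hq
    rw [norm_mul, Real.norm_eq_abs, Real.norm_eq_abs, abs_of_nonneg (hρ0 _)]
    by_cases hxq : ε < dist x q
    · rw [hρz (x - q) (by rwa [← dist_eq_norm])]; simp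
    · apply mul_le_mul_of_nonneg_right _ (hρ0 _)
      have h1 := hba q hq i
      have h2 := hεb q hq x (not_lt.1 hxq) i
      rw [abs_le] at *
      constructor <;> linarith [h1.1, h1.2, h2.1, h2.2]
  -- test function
  have hρL : LocallyIntegrable ρ := hρC.locallyIntegrable
  set φ : E3 → ℝ := fun y => ∫ t, ρ t * v (y - t) with hφ
  have hφs : ContDiff ℝ ∞ φ := conv_smooth volume hρL hvs hvc
  have hφ0 : ∀ x, 0 ≤ φ x := fun x => integral_nonneg fun t => mul_nonneg (hρ0 _) (hv0 _)
  have hpd : ∀ i, pd φ i = fun y => ∫ t, ρ t * pd v i (y - t) := by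
    intro i; ext y; exact conv_pd hρL hvs hvc i y
  have hpd2 : ∀ i, pd2 φ i i = fun y => ∫ t, ρ t * pd2 v i i (y - t) := by
    intro i; ext y
    unfold pd2
    rw [hpd]
    exact conv_pd hρL (pd_smooth hvs i) (pd_compact hvc i) i y
  have hvC := hvs.continuous
  have hv1 : ContDiff ℝ 1 v := hvs.of_le (by simp)
  have hpC : ∀ i, Continuous fun x => pd v i x := fun i => (pd_smooth hvs i).continuous
  have hp1 : ∀ i, ContDiff ℝ 1 fun x => pd v i x := fun i => (pd_smooth hvs i).of_le (by simp)
  have hpc : ∀ i, HasCompactSupport fun x => pd v i x := fun i => pd_compact hvc i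
  have key := h φ hφs (fun x _ => hφ0 x)
  have i2 : ∀ i, Integrable (fun x => pd2 φ i i x) μ := fun i =>
    cI (pd_smooth (pd_smooth hφs i) i).continuous
  have i1 : ∀ i, Integrable (fun x => a x i * pd φ i x) μ := by
    intro i
    have hcc : Continuous fun x => pd φ i x := (pd_smooth hφs i).continuous
    obtain ⟨C, hC⟩ := hQ.exists_bound_of_continuousOn hcc.continuousOn
    apply (haI i).mul_bdd (c := C) hcc.aestronglyMeasurable
    filter_upwards [aeQ] with q hq using hC q hq
  have i0 : Integrable φ μ := cI hφs.continuous
  have il : Integrable (fun x => lap φ x) μ := by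
    unfold lap
    exact integrable_finsetSum _ fun i _ => i2 i
  have is1 : Integrable (fun x => ∑ i, a x i * pd φ i x) μ :=
    integrable_finsetSum _ fun i _ => i1 i
  set S := ∫ x, v x ^ 2 with hS
  set D : Fin 3 → ℝ := fun i => ∫ x, pd v i x ^ 2 with hD
  have sD : ∫ x, ∑ i, pd v i x ^ 2 = ∑ i, D i := by
    rw [integral_finsetSum]
    intro i _
    exact smooth_int ((hpC i).pow 2) (by simp_rw [sq]; exact (hpc i).mul_left)
  have f0 : ∫ x, φ x ∂μ = S := by
    have := fub μ h1I hρC hρc hρe hvC hvc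
    simp only [one_mul] at this
    rw [hφ, this, hS]
    congr 1; ext x; rw [hv]; simp only [one_mul]; ring
  have f2 : ∀ i, ∫ x, pd2 φ i i x ∂μ = - D i := by
    intro i
    have hc2 : Continuous fun x => pd2 v i i x := (pd_smooth (pd_smooth hvs i) i).continuous
    have hk2 : HasCompactSupport fun x => pd2 v i i x := pd_compact (hpc i) i
    have := fub μ h1I hρC hρc hρe hc2 hk2
    rw [hpd2]
    simp only [one_mul] at this
    rw [this]
    have e := ibp hv1 (hp1 i) (hpc i) i
    have e' : ∫ x, pd2 v i i x * ∫ q, ρ (x - q) ∂μ = ∫ x, v x * pd (fun x => pd v i x) i x := by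
      congr 1; ext x; rw [hv]; simp only [one_mul]; rw [mul_comm]; rfl
    rw [e', e, hD]
    congr 1
    congr 1; ext x; ring
  have f1 : ∀ i, ∫ x, a x i * pd φ i x ∂μ = ∫ x, pd v i x * A i x := by
    intro i
    rw [hpd]
    exact fub μ (haI i) hρC hρc hρe (hpC i) (hpc i)
  have key2 : d * (∑ i, D i) + (∑ i, ∫ x, pd v i x * A i x) - l * S ≤ 0 := by
    have il' : Integrable (fun x => -d * lap φ x) μ := il.const_mul _
    have il2 : Integrable (fun x => -d * lap φ x + ∑ i, a x i * pd φ i x) μ := il'.add is1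
    rw [integral_sub il2 (i0.const_mul _),
      integral_add il' is1, integral_const_mul, integral_const_mul, f0,
      integral_finsetSum _ (fun i _ => i1 i)] at key
    have : ∫ x, lap φ x ∂μ = - ∑ i, D i := by
      unfold lap
      rw [integral_finsetSum _ (fun i _ => i2 i), ← Finset.sum_neg_distrib]
      exact Finset.sum_congr rfl fun i _ => f2 i
    rw [this, Finset.sum_congr rfl (fun i _ => f1 i)] at key
    linarith
  have vv : HasCompactSupport fun x => v x ^ 2 := by simp_rw [sq]; exact hvc.mul_left
  have vI : Integrable fun x => v x ^ 2 := smooth_int (hvC.pow 2) vv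
  have pI : ∀ i, Integrable fun x => pd v i x ^ 2 := fun i =>
    smooth_int ((hpC i).pow 2) (by simp_rw [sq]; exact (hpc i).mul_left)
  have dr : ∀ i, (∫ x, pd v i x * (b i x * v x)) - τ * D i - τ * S ≤ ∫ x, pd v i x * A i x := by
    intro i
    rw [hD, hS]
    simp only
    rw [← integral_const_mul, ← integral_const_mul]
    have j1 : Integrable fun x => pd v i x * (b i x * v x) :=
      smooth_int ((hpC i).mul ((hb i).continuous.mul hvC)) (hpc i).mul_right
    have j2 : Integrable fun x => pd v i x * (b i x * v x) - τ * pd v i x ^ 2 :=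
      j1.sub ((pI i).const_mul _)
    rw [← integral_sub j1 ((pI i).const_mul _), ← integral_sub j2 (vI.const_mul _)]
    apply integral_mono (j2.sub (vI.const_mul _))
      (smooth_int ((hpC i).mul (hAs i).continuous) (hpc i).mul_right)
    intro x
    simp only
    have h1 := hAb i x
    have h2 : |pd v i x * (A i x - b i x * v x)| ≤ |pd v i x| * (2 * τ * v x) := by
      rw [abs_mul]; exact mul_le_mul_of_nonneg_left h1 (abs_nonneg _)
    have h3 := (abs_le.1 h2).1
    have h4 : |pd v i x| * (2 * τ * v x) ≤ τ * pd v i x ^ 2 + τ * v x ^ 2 := by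
      rw [← sq_abs (pd v i x)]
      nlinarith [mul_nonneg hτ0.le (sq_nonneg (|pd v i x| - v x))]
    have h5 : pd v i x * (A i x - b i x * v x) = pd v i x * A i x - pd v i x * (b i x * v x) := by
      ring
    show pd v i x * (b i x * v x) - τ * pd v i x ^ 2 - τ * v x ^ 2 ≤ pd v i x * A i x
    linarith
  have bI : ∀ i, Continuous fun x => pd (b i) i x := fun i =>
    ((hb i).continuous_fderiv (by simp)).clm_apply continuous_const
  have dv : ∀ i, ∫ x, pd v i x * (b i x * v x) = - (1/2) * ∫ x, pd (b i) i x * v x ^ 2 := by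
    intro i
    have e := ibp ((hb i).mul hv1) hv1 hvc i
    have e2 : ∀ x, pd (fun y => b i y * v y) i x * v x
        = pd (b i) i x * v x ^ 2 + pd v i x * (b i x * v x) := by
      intro x
      rw [pd_mul ((hb i).differentiable (by simp) x) (hv1.differentiable (by simp) x)]
      ring
    have e3 : ∫ x, b i x * v x * pd v i x = ∫ x, pd v i x * (b i x * v x) := by
      congr 1; ext x; ring
    simp_rw [e2] at e
    rw [e3, integral_add] at e
    · linarith
    · exact smooth_int ((bI i).mul (hvC.pow 2)) vv.mul_left
    · exact smooth_int ((hpC i).mul ((hb i).continuous.mul hvC)) (hpc i).mul_right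
  have dd : - τ * S ≤ ∑ i, ∫ x, pd v i x * (b i x * v x) := by
    simp_rw [dv]
    rw [← Finset.mul_sum, ← integral_finsetSum]
    · have : ∫ x, ∑ i, pd (b i) i x * v x ^ 2 ≤ ∫ x, 2 * τ * v x ^ 2 := by
        apply integral_mono
        · exact integrable_finsetSum _ fun i _ => smooth_int ((bI i).mul (hvC.pow 2)) vv.mul_left
        · exact vI.const_mul _
        · intro x
          simp only
          rw [← Finset.sum_mul]
          by_cases hx : v x = 0
          · simp [hx]
          · obtain ⟨q, hq, hxq⟩ := hth x hx
            have h1 := (abs_le.1 (hεd q hq x hxq)).2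
            have h2 := (abs_le.1 (hbdiv q hq)).2
            exact mul_le_mul_of_nonneg_right (by linarith) (sq_nonneg _)
      rw [integral_const_mul] at this
      linarith
    · intro i _
      exact smooth_int ((bI i).mul (hvC.pow 2)) vv.mul_left
  have fin : (d - τ) * ∑ i, D i ≤ (l + 4 * τ) * S := by
    have := Finset.sum_le_sum fun i (_ : i ∈ Finset.univ) => dr i
    simp only [Finset.sum_sub_distrib, ← Finset.mul_sum, Finset.sum_const, Finset.card_univ, Fintype.card_fin] at this
    simp at this
    linarith
  have hS0 : 0 ≤ S := integral_nonneg fun x => sq_nonneg _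
  rw [sD] at hLY
  have hSz : S = 0 := by
    by_contra hne
    have hSp : 0 < S := lt_of_le_of_ne hS0 (Ne.symm hne)
    have : (d - τ) * (c * S) ≤ (l + 4 * τ) * S :=
      (mul_le_mul_of_nonneg_left hLY (by linarith)).trans fin
    have : ((d - τ) * c) * S ≤ (l + 4 * τ) * S := by linarith
    have := le_of_mul_le_mul_right this hSp
    linarith
  have hvzero : ∀ x, v x = 0 := by
    have h0 := (integral_eq_zero_iff_of_nonneg (fun x => sq_nonneg (v x)) vI).1 hSz
    have h1 : (fun x => v x ^ 2) = fun _ => (0:ℝ) :=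
      (Continuous.ae_eq_iff_eq volume (hvC.pow 2) continuous_const).1 h0
    intro x
    have := congrFun h1 x
    simpa using this
  -- total mass
  have hball : ∀ x : E3, μ {q | ρ (x - q) ≠ 0} = 0 := by
    intro x
    have h1 := hvzero x
    simp only [hv, one_mul] at h1
    have h2 := (integral_eq_zero_iff_of_nonneg (fun q => hρ0 (x - q))
      (cI (by fun_prop))).1 h1
    exact h2
  rw [← Measure.measure_univ_eq_zero]
  apply measure_null_of_locally_null
  intro x _
  refine ⟨_, ?_, hball x⟩
  rw [nhdsWithin_univ]
  have : ContinuousAt (fun q => ρ (x - q)) x := by fun_prop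
  exact this.eventually_ne (by simpa using hρp)

def LL (d l : ℝ) (a : E3 → E3) (φ : E3 → ℝ) (x : E3) : ℝ :=
  -d * lap φ x + (∑ i, a x i * pd φ i x) - l * φ x

lemma pd_lin {p q : E3 → ℝ} (hp : Differentiable ℝ p) (hq : Differentiable ℝ q) (s t : ℝ)
    (i : Fin 3) (x : E3) :
    pd (fun y => s * p y + t * q y) i x = s * pd p i x + t * pd q i x := by
  unfold pd
  rw [fderiv_fun_add ((hp x).const_mul s) ((hq x).const_mul t), fderiv_const_mul (hp x),
    fderiv_const_mul (hq x)]
  simp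

lemma lap_lin {p q : E3 → ℝ} (hp : ContDiff ℝ ∞ p) (hq : ContDiff ℝ ∞ q) (s t : ℝ) (x : E3) :
    lap (fun y => s * p y + t * q y) x = s * lap p x + t * lap q x := by
  unfold lap pd2
  rw [Finset.mul_sum, Finset.mul_sum, ← Finset.sum_add_distrib]
  refine Finset.sum_congr rfl fun i _ => ?_
  have : (fun y => pd (fun y => s * p y + t * q y) i y) = fun y => s * pd p i y + t * pd q i y := by
    ext y
    exact pd_lin (hp.differentiable (by simp)) (hq.differentiable (by simp)) s t i y
  rw [this]
  exact pd_lin ((pd_smooth hp i).differentiable (by simp)) ((pd_smooth hq i).differentiable (by simp)) s t i x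

lemma LL_lin (d l : ℝ) (a : E3 → E3) {p q : E3 → ℝ} (hp : ContDiff ℝ ∞ p) (hq : ContDiff ℝ ∞ q)
    (s t : ℝ) (x : E3) :
    LL d l a (fun y => s * p y + t * q y) x = s * LL d l a p x + t * LL d l a q x := by
  unfold LL
  rw [lap_lin hp hq]
  simp_rw [pd_lin (hp.differentiable (by simp)) (hq.differentiable (by simp)), mul_add,
    Finset.sum_add_distrib, mul_sub, mul_add, Finset.mul_sum]
  have e1 : ∀ (r : ℝ) (w : Fin 3 → ℝ), ∑ i, a x i * (r * w i) = ∑ i, r * (a x i * w i) := by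
    intro r w
    exact Finset.sum_congr rfl fun i _ => by ring
  rw [e1, e1]
  ring

lemma LL_cont (d l : ℝ) (a : E3 → E3) {Q : Set E3} (ha : ContinuousOn a Q) {p : E3 → ℝ}
    (hp : ContDiff ℝ ∞ p) : ContinuousOn (LL d l a p) Q := by
  unfold LL
  have h1 : Continuous fun x => lap p x := by
    unfold lap
    exact continuous_finsetSum _ fun i _ => (pd_smooth (pd_smooth hp i) i).continuous
  have h2 : ∀ i, Continuous fun x => pd p i x := fun i => (pd_smooth hp i).continuous
  have h3 : Continuous p := hp.continuous
  have h4 : ContinuousOn (fun x => ∑ i, a x i * pd p i x) Q := by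
    apply continuousOn_finsetSum
    intro i _
    have : ContinuousOn (fun x => a x i) Q := by fun_prop
    exact this.mul (h2 i).continuousOn
  exact ((h1.const_smul (-d)).continuousOn.add h4).sub (h3.const_smul l).continuousOn

open scoped CompactlySupported in
lemma riesz_rep {K : Type*} [TopologicalSpace K] [CompactSpace K] [T2Space K] [MeasurableSpace K]
    [BorelSpace K] (Λ : C(K, ℝ) → ℝ) (hadd : ∀ p q, Λ (p + q) = Λ p + Λ q)
    (hsmul : ∀ (c : ℝ) p, Λ (c • p) = c * Λ p)
    (hΛ : ∀ p : C(K, ℝ), (∀ x, 0 ≤ p x) → 0 ≤ Λ p) :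
    ∃ μ : Measure K, IsFiniteMeasure μ ∧ ∀ p : C(K, ℝ), ∫ x, p x ∂μ = Λ p := by
  let L : C_c(K, ℝ) →ₗ[ℝ] ℝ :=
    { toFun := fun f => Λ f.toContinuousMap
      map_add' := fun f g => hadd f.toContinuousMap g.toContinuousMap
      map_smul' := fun c f => hsmul c f.toContinuousMap }
  let P : C_c(K, ℝ) →ₚ[ℝ] ℝ := PositiveLinearMap.mk₀ L (fun f hf => hΛ f.toContinuousMap (fun x => hf x))
  refine ⟨RealRMK.rieszMeasure P, inferInstance, fun p => ?_⟩
  have := RealRMK.integral_rieszMeasure P ⟨p, HasCompactSupport.of_compactSpace p⟩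
  exact this

lemma exists_super (Ω : Set E3) (hopen : IsOpen Ω) (hbdd : Bornology.IsBounded Ω)
    (hbd : HasCkBoundary ⊤ Ω) (a : E3 → E3) (ha : ContDiffOn ℝ 1 a (closure Ω))
    (hdiv : ∀ x ∈ Ω, (∑ i, pd (fun y => a y i) i x) = 0) (d l V R : ℝ) (hl : 0 < l) (hd : 0 < d)
    (hV0 : 0 < V) (hR : 0 < R)
    (hV : volume Ω < ENNReal.ofReal V) (hc : l < d * (4*π^2*R^2*(1 - V*(8*π/15)*R^3))) :
    ∃ φ : E3 → ℝ, ContDiff ℝ ∞ φ ∧ ∀ x ∈ closure Ω, 0 < φ x ∧ 0 < LL d l a φ x := by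
  by_contra hcon
  push Not at hcon
  have hQ : IsCompact (closure Ω) := hbdd.isCompact_closure
  let K := closure Ω
  have : CompactSpace K := isCompact_iff_compactSpace.1 hQ
  let Lm : {φ : E3 → ℝ // ContDiff ℝ ∞ φ} → C(K, ℝ) := fun φ =>
    ⟨fun x => LL d l a φ.1 x, (LL_cont d l a ha.continuousOn φ.2).domRestrict⟩
  let Im : {φ : E3 → ℝ // ContDiff ℝ ∞ φ} → C(K, ℝ) := fun φ =>
    ⟨fun x => φ.1 x, φ.2.continuous.comp continuous_subtype_val⟩
  let T : Set (C(K, ℝ) × C(K, ℝ)) := Set.range fun φ => (Lm φ, Im φ)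
  let P1 : Set C(K, ℝ) := {p | ∀ x, 0 < p x}
  have hP1o : IsOpen P1 := by
    have := ContinuousMap.isOpen_setOfPred_mapsTo (X := K) (Y := ℝ) isCompact_univ (isOpen_Ioi (a := (0:ℝ)))
    convert! this using 1
    ext p
    simp [P1, Set.MapsTo]
  have hP1c : Convex ℝ P1 := by
    intro p hp q hq s t hs ht hst x
    have h1 := hp x
    have h2 := hq x
    show 0 < s * p x + t * q x
    rcases hs.eq_or_lt with h | h
    · have : t = 1 := by linarith
      rw [← h, this]; linarith
    · have := mul_pos h h1
      have := mul_nonneg ht h2.le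
      linarith
  have comb : ∀ (φ ψ : {φ : E3 → ℝ // ContDiff ℝ ∞ φ}) (s t : ℝ),
      s • (Lm φ, Im φ) + t • (Lm ψ, Im ψ) ∈ T := by
    intro φ ψ s t
    refine ⟨⟨fun y => s * φ.1 y + t * ψ.1 y, (contDiff_const.mul φ.2).add (contDiff_const.mul ψ.2)⟩, ?_⟩
    refine Prod.ext ?_ ?_
    · ext x
      exact LL_lin d l a φ.2 ψ.2 s t x
    · ext x
      rfl
  have hTc : Convex ℝ T := by
    rintro _ ⟨φ, rfl⟩ _ ⟨ψ, rfl⟩ s t _ _ _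
    exact comb φ ψ s t
  have hdisj : Disjoint (P1 ×ˢ P1) T := by
    rw [Set.disjoint_left]
    rintro _ h ⟨φ, rfl⟩
    obtain ⟨x, hx, h1⟩ := hcon φ.1 φ.2
    exact absurd (h.1 ⟨x, hx⟩) (not_lt.2 (h1 (h.2 ⟨x, hx⟩)))
  obtain ⟨F, u, hF1, hF2⟩ := geometric_hahn_banach_open (hP1c.prod hP1c) (hP1o.prod hP1o) hTc hdisj
  have hFT : ∀ φ, F (Lm φ, Im φ) = 0 := by
    intro φ
    by_contra hne
    have h1 := hF2 _ (comb φ φ ((u - 1) / F (Lm φ, Im φ)) 0)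
    rw [zero_smul, add_zero, map_smul, smul_eq_mul, div_mul_cancel₀ _ hne] at h1
    linarith
  have hu : u ≤ 0 := by
    have := hF2 _ ⟨⟨fun _ => 0, contDiff_const⟩, rfl⟩
    rwa [hFT] at this
  have hFP : ∀ p q : C(K, ℝ), (∀ x, 0 < p x) → (∀ x, 0 < q x) → F (p, q) < 0 := fun p q hp hq =>
    (hF1 (p, q) ⟨hp, hq⟩).trans_le hu
  have hF11 : F (1, 1) < 0 := hFP 1 1 (fun x => by simp) (fun x => by simp)
  have hFN : ∀ p q : C(K, ℝ), (∀ x, 0 ≤ p x) → (∀ x, 0 ≤ q x) → F (p, q) ≤ 0 := by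
    intro p q hp hq
    by_contra hgt
    push Not at hgt
    set δ := F (p, q) / (- F (1,1)) with hδ
    have hδ0 : 0 < δ := div_pos hgt (by linarith)
    have h1 := hFP (p + δ • 1) (q + δ • 1) (fun x => by
      have := hp x
      simp; linarith) (fun x => by
      have := hq x
      simp; linarith)
    have h2 : ((p + δ • 1, q + δ • 1) : C(K, ℝ) × C(K, ℝ)) = (p, q) + δ • (1, 1) := rfl
    rw [h2, map_add, map_smul, smul_eq_mul, hδ] at h1
    have : F (p, q) / (- F (1,1)) * F (1,1) = - F (p, q) := by
      have := hF11.ne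
      field_simp
    linarith
  obtain ⟨m1, hm1, hm⟩ := riesz_rep (K := K) (fun p => - F (p, 0))
    (fun p q => by
      have : ((p + q, 0) : C(K, ℝ) × C(K, ℝ)) = (p, 0) + (q, 0) := by simp
      rw [this, map_add]; ring)
    (fun c p => by
      have : ((c • p, 0) : C(K, ℝ) × C(K, ℝ)) = c • (p, 0) := by simp
      rw [this, map_smul, smul_eq_mul]; ring)
    (fun p hp => by
      have := hFN p 0 hp (fun x => by simp)
      linarith)
  have hsplit : ∀ p q : C(K, ℝ), F (p, q) = F (p, 0) + F (0, q) := by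
    intro p q
    rw [← map_add]; simp
  have hemb : MeasurableEmbedding (Subtype.val : K → E3) :=
    MeasurableEmbedding.subtype_coe hQ.isClosed.measurableSet
  have hmu := dual_zero Ω hopen hbdd hbd a ha hdiv d l V R hl hd hV0 hR hV hc (m1.map Subtype.val)
    (by
      rw [hemb.map_apply]
      convert measure_empty (μ := m1)
      ext x
      simp [K])
    (by
      intro φ hφ hφ0
      rw [hemb.integral_map]
      have e := hm (Lm ⟨φ, hφ⟩)
      have e2 := hFT ⟨φ, hφ⟩
      have e3 := hFN 0 (Im ⟨φ, hφ⟩) (fun x => by simp) (fun x => hφ0 x x.2)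
      rw [hsplit] at e2
      refine le_trans (le_of_eq e) ?_
      linarith)
  have hm10 : m1 = 0 := by
    rw [← Measure.measure_univ_eq_zero]
    have h1 : (m1.map Subtype.val) (Set.univ : Set E3) = 0 := by rw [hmu]; simp
    rwa [hemb.map_apply, Set.preimage_univ] at h1
  have hz : ∀ p, F (p, 0) = 0 := by
    intro p
    have := hm p
    rw [hm10] at this
    simp at this
    linarith
  have h1 := hFT ⟨fun _ => 1, contDiff_const⟩
  have h2 : Im ⟨fun _ => 1, contDiff_const⟩ = 1 := rfl
  rw [hsplit, hz, h2] at h1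
  rw [hsplit, hz] at hF11
  linarith

lemma left_deriv_nonneg {h : ℝ → ℝ} {h' t : ℝ} (hd : HasDerivAt h h' t) (ht : 0 < t)
    (hm : ∀ s, 0 ≤ s → s ≤ t → h s ≤ h t) : 0 ≤ h' := by
  have h1 := (hasDerivWithinAt_iff_tendsto_slope' (s := Set.Iio t) (by simp)).1 hd.hasDerivWithinAt
  refine ge_of_tendsto h1 ?_
  filter_upwards [Ioo_mem_nhdsLT ht] with s hs
  rw [slope_def_field]
  apply div_nonneg_of_nonpos
  · linarith [hm s hs.1.le hs.2.le]
  · linarith [hs.2]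

lemma second_deriv_nonpos {z : E3 → ℝ} {x : E3} (hz : ContDiffAt ℝ 2 z x) (hm : IsLocalMax z x)
    (i : Fin 3) : pd2 z i i x ≤ 0 := by
  set e : E3 := EuclideanSpace.single i 1 with he
  by_contra hpos
  push Not at hpos
  let γ : ℝ → E3 := fun s => x + s • e
  have hγ : ∀ s, HasDerivAt γ e s := by
    intro s
    have := ((hasDerivAt_id s).smul_const e).const_add x
    rw [one_smul] at this
    exact this
  have hγ0 : γ 0 = x := by simp [γ]
  have hγt : Tendsto γ (𝓝 0) (𝓝 x) := by
    have := (hγ 0).continuousAt.tendsto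
    rwa [hγ0] at this
  have ev : ∀ᶠ y in 𝓝 x, DifferentiableAt ℝ z y := by
    filter_upwards [hz.eventually (by simp)] with y hy using hy.differentiableAt (by simp)
  have hd1 : deriv (fun s => z (γ s)) =ᶠ[𝓝 0] fun s => pd z i (γ s) := by
    filter_upwards [hγt.eventually ev] with s hs
    exact (hs.hasFDerivAt.comp_hasDerivAt s (hγ s)).deriv
  have hpdd : DifferentiableAt ℝ (fun y => pd z i y) x := by
    unfold pd
    have : DifferentiableAt ℝ (fderiv ℝ z) x :=
      (hz.fderiv_right (m := 1) (by norm_num)).differentiableAt (by simp)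
    exact this.clm_apply (differentiableAt_const _)
  have hd2 : deriv (deriv (fun s => z (γ s))) 0 = pd2 z i i x := by
    rw [hd1.deriv_eq]
    have h1 : HasFDerivAt (fun y => pd z i y) (fderiv ℝ (fun y => pd z i y) x) (γ 0) := by
      rw [hγ0]; exact hpdd.hasFDerivAt
    exact (h1.comp_hasDerivAt 0 (hγ 0)).deriv
  have hmax : ∀ᶠ s in 𝓝 (0:ℝ), z (γ s) ≤ z (γ 0) := by
    rw [hγ0]; exact hγt.eventually hm
  have hd0 : deriv (fun s => z (γ s)) 0 = 0 := IsLocalMax.deriv_eq_zero hmax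
  have hcz : ContinuousAt (fun s => z (γ s)) 0 := by
    have h1 : ContinuousAt z (γ 0) := by rw [hγ0]; exact hz.continuousAt
    exact ContinuousAt.comp (g := z) h1 (hγ 0).continuousAt
  have hmin := isLocalMin_of_deriv_deriv_pos (f := fun s => z (γ s)) (by rw [hd2]; exact hpos) hd0 hcz
  have hconst : (fun s => z (γ s)) =ᶠ[𝓝 0] fun _ => z (γ 0) := by
    filter_upwards [hmin, hmax] with s h1 h2 using le_antisymm h2 h1
  have : deriv (deriv (fun s => z (γ s))) 0 = 0 := by
    rw [hconst.deriv.deriv_eq]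
    simp
  rw [hd2] at this
  linarith

lemma compare_super (Ω : Set E3) (hopen : IsOpen Ω) (hbdd : Bornology.IsBounded Ω)
    (a : E3 → E3) (d l k B : ℝ) (hd : 0 < d) (hB : 0 < B) (f : ℝ → ℝ)
    (hf : ∀ N, 0 ≤ N → f N ≤ k * N) (φ : E3 → ℝ) (hφ : ContDiff ℝ ∞ φ)
    (hφ1 : ∀ x ∈ closure Ω, 0 < φ x ∧ 0 < LL d l a φ x)
    (u : E3 → ℝ → ℝ) (u0 : ∀ x ∈ closure Ω, ∀ t ∈ Set.Icc (0:ℝ) 1, 0 ≤ u x t)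
    (uc : ContinuousOn (fun p : E3 × ℝ => u p.1 p.2) (closure Ω ×ˢ Set.Icc (0:ℝ) 1))
    (u2 : ∀ t ∈ Set.Ioc (0:ℝ) 1, ∀ x ∈ Ω, ContDiffAt ℝ 2 (fun y => u y t) x)
    (u1 : ∀ x ∈ Ω, ∀ t ∈ Set.Ioc (0:ℝ) 1, ContDiffAt ℝ 1 (fun s => u x s) t)
    (pde : ∀ x ∈ Ω, ∀ t ∈ Set.Ioc (0:ℝ) 1, deriv (fun s => u x s) t =
      d * lap (fun y => u y t) x - (∑ i, a x i * pd (fun y => u y t) i x) + f (u x t))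
    (bdry : ∀ x ∈ frontier Ω, ∀ t ∈ Set.Ioc (0:ℝ) 1, u x t = 0)
    (init : ∀ x ∈ closure Ω, u x 0 ≤ B * φ x) :
    ∀ x ∈ closure Ω, u x 1 ≤ B * Real.exp (k - l) * φ x := by
  have hQ : IsCompact (closure Ω) := hbdd.isCompact_closure
  let G : E3 × ℝ → ℝ := fun p => u p.1 p.2 * Real.exp (-k * p.2) - B * Real.exp (-l * p.2) * φ p.1
  have hGc : ContinuousOn G (closure Ω ×ˢ Set.Icc (0:ℝ) 1) := by
    have h1 : Continuous fun p : E3 × ℝ => Real.exp (-k * p.2) := by fun_prop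
    have h2 : Continuous fun p : E3 × ℝ => B * Real.exp (-l * p.2) * φ p.1 := by
      have := hφ.continuous
      fun_prop
    exact (uc.mul h1.continuousOn).sub h2.continuousOn
  suffices hle : ∀ p ∈ closure Ω ×ˢ Set.Icc (0:ℝ) 1, G p ≤ 0 by
    intro x hx
    have h1 := hle (x, 1) ⟨hx, by simp⟩
    simp only [G, mul_one] at h1
    have h2 : Real.exp (k - l) = Real.exp (-l) * Real.exp k := by
      rw [← Real.exp_add]; ring_nf
    have h3 : Real.exp (-k) * Real.exp k = 1 := by rw [← Real.exp_add]; simp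
    have h4 := mul_le_mul_of_nonneg_right h1 (Real.exp_pos k).le
    rw [h2]
    have h5 : (u x 1 * Real.exp (-k) - B * Real.exp (-l) * φ x) * Real.exp k
      = u x 1 * (Real.exp (-k) * Real.exp k) - B * (Real.exp (-l) * Real.exp k) * φ x := by ring
    rw [h5, h3] at h4
    linarith
  by_contra hcon
  push Not at hcon
  obtain ⟨p1, hp1, hp1G⟩ := hcon
  obtain ⟨⟨x, t⟩, ⟨hx, ht⟩, hmax⟩ := (hQ.prod isCompact_Icc).exists_isMaxOn ⟨p1, hp1⟩ hGc
  simp only at hx ht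
  have hGpos : 0 < G (x, t) := hp1G.trans_le (hmax hp1)
  have ht0 : 0 < t := by
    rcases ht.1.eq_or_lt with h | h
    · exfalso
      have := init x hx
      simp [G, ← h] at hGpos
      linarith
    · exact h
  have ht' : t ∈ Set.Ioc (0:ℝ) 1 := ⟨ht0, ht.2⟩
  have hxΩ : x ∈ Ω := by
    rw [closure_eq_self_union_frontier] at hx
    rcases hx with h | h
    · exact h
    · exfalso
      have h1 := bdry x h t ht'
      have h2 := (hφ1 x (frontier_subset_closure h)).1
      simp only [G, h1, zero_mul, zero_sub] at hGpos
      have : 0 < B * Real.exp (-l * t) * φ x := by positivity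
      linarith
  have hQx : closure Ω ∈ 𝓝 x := mem_of_superset (hopen.mem_nhds hxΩ) subset_closure
  set B' := B * Real.exp (-l * t) * Real.exp (k * t) with hB'
  have hee : Real.exp (-k * t) * Real.exp (k * t) = 1 := by rw [← Real.exp_add]; simp
  have hB'0 : 0 < B' := by positivity
  have hux := u2 t ht' x hxΩ
  set U : E3 → ℝ := fun y => u y t with hU
  have hφ2 : ContDiff ℝ 2 φ := hφ.of_le (by norm_cast)
  let z : E3 → ℝ := fun y => U y - B' * φ y
  have hz2 : ContDiffAt ℝ 2 z x := hux.sub (contDiff_const.mul hφ2).contDiffAt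
  have hzG : ∀ y, z y = G (y, t) * Real.exp (k * t) := by
    intro y
    simp only [z, G, hU, hB']
    linear_combination (-(u y t)) * hee
  have hzm : IsLocalMax z x := by
    filter_upwards [hQx] with y hy
    rw [hzG, hzG]
    exact mul_le_mul_of_nonneg_right (hmax (⟨hy, ht⟩ : (y, t) ∈ closure Ω ×ˢ Set.Icc (0:ℝ) 1))
      (Real.exp_pos _).le
  have evU : ∀ᶠ y in 𝓝 x, DifferentiableAt ℝ U y := by
    filter_upwards [hux.eventually (by simp)] with y hy using hy.differentiableAt (by simp)
  have hφd : Differentiable ℝ φ := hφ.differentiable (by simp)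
  have pdz : ∀ i, ∀ᶠ y in 𝓝 x, pd z i y = pd U i y - B' * pd φ i y := by
    intro i
    filter_upwards [evU] with y hy
    simp only [z, pd]
    rw [fderiv_fun_sub hy ((hφd y).const_mul _), fderiv_const_mul (hφd y)]
    simp
  have hg0 : ∀ i, pd U i x = B' * pd φ i x := by
    intro i
    have h1 := (pdz i).self_of_nhds
    have h2 : pd z i x = 0 := by
      unfold pd
      rw [hzm.fderiv_eq_zero]; simp
    linarith
  have hUd : ∀ i, DifferentiableAt ℝ (fun y => pd U i y) x := by
    intro i
    unfold pd
    have : DifferentiableAt ℝ (fderiv ℝ U) x :=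
      (hux.fderiv_right (m := 1) (by norm_num)).differentiableAt (by simp)
    exact this.clm_apply (differentiableAt_const _)
  have hg2 : ∀ i, pd2 U i i x ≤ B' * pd2 φ i i x := by
    intro i
    have h1 := second_deriv_nonpos hz2 hzm i
    have hφi : DifferentiableAt ℝ (fun y => pd φ i y) x := (pd_smooth hφ i).differentiable (by simp) x
    have h2 : pd2 z i i x = pd2 U i i x - B' * pd2 φ i i x := by
      unfold pd2
      rw [pd_congr (pdz i)]
      conv_lhs => unfold pd
      have := fderiv_fun_sub (hUd i) (hφi.const_mul B')
      erw [this, fderiv_const_mul hφi]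
      rfl
    linarith
  have hlap : lap U x ≤ B' * lap φ x := by
    unfold lap
    rw [Finset.mul_sum]
    exact Finset.sum_le_sum fun i _ => hg2 i
  have hsum : ∑ i, a x i * pd U i x = B' * ∑ i, a x i * pd φ i x := by
    rw [Finset.mul_sum]
    refine Finset.sum_congr rfl fun i _ => ?_
    rw [hg0]; ring
  have hfu := hf (u x t) (u0 x hx t ht)
  have hpde := pde x hxΩ t ht'
  rw [← hU, hsum] at hpde
  set ut := deriv (fun s => u x s) t with hut
  have hLL := (hφ1 x hx).2
  have hup : ut - k * u x t ≤ - B' * (LL d l a φ x + l * φ x) := by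
    unfold LL
    have := mul_le_mul_of_nonneg_left hlap hd.le
    linarith
  have hder : HasDerivAt (fun s => G (x, s))
      (Real.exp (-k * t) * (ut - k * u x t) + l * (B * Real.exp (-l * t) * φ x)) t := by
    have h1 : HasDerivAt (fun s => u x s) ut t :=
      ((u1 x hxΩ t ht').differentiableAt (by simp)).hasDerivAt
    have h2 : ∀ c : ℝ, HasDerivAt (fun s => Real.exp (-c * s)) (Real.exp (-c * t) * (-c)) t := by
      intro c
      have : HasDerivAt (fun s : ℝ => -c * s) (-c) t := by
        simpa using (hasDerivAt_id t).const_mul (-c)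
      exact this.exp
    have := (h1.mul (h2 k)).sub (((h2 l).const_mul B).mul_const (φ x))
    convert! this using 1
    ring
  have hnn := left_deriv_nonneg hder ht0 (fun s hs0 hst =>
    hmax (⟨hx, ⟨hs0, hst.trans ht.2⟩⟩ : (x, s) ∈ closure Ω ×ˢ Set.Icc (0:ℝ) 1))
  have h6 := mul_le_mul_of_nonneg_left hup (Real.exp_pos (-k * t)).le
  have h7 : Real.exp (-k * t) * (-B' * (LL d l a φ x + l * φ x))
      = - (B * Real.exp (-l * t)) * (LL d l a φ x + l * φ x) := by
    rw [hB']
    linear_combination (- (B * Real.exp (-l * t)) * (LL d l a φ x + l * φ x)) * hee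
  rw [h7] at h6
  have h8 : 0 < B * Real.exp (-l * t) * LL d l a φ x := by positivity
  linarith

lemma choose_params (d r : ℝ) (hd : 0 < d) (hr : 0 < r) (v : ℝ≥0∞)
    (hv : v < ENNReal.ofReal (18 * Real.sqrt 3 * Real.pi ^ 2 / (5 * Real.sqrt 5) *
      (d / r) ^ ((3 : ℝ) / 2))) :
    ∃ V R l : ℝ, 0 < V ∧ 0 < R ∧ r < l ∧ v < ENNReal.ofReal V ∧
      l < d * (4*π^2*R^2*(1 - V*(8*π/15)*R^3)) := by
  set q := Real.sqrt (d / r) with hq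
  have hq0 : 0 < q := Real.sqrt_pos.2 (div_pos hd hr)
  have hq2 : q ^ 2 = d / r := Real.sq_sqrt (div_pos hd hr).le
  have hq3 : (d / r) ^ ((3 : ℝ) / 2) = q ^ 3 := by
    rw [hq, Real.sqrt_eq_rpow, ← Real.rpow_natCast, ← Real.rpow_mul (div_pos hd hr).le]
    norm_num
  have h3 : Real.sqrt 3 ^ 2 = 3 := Real.sq_sqrt (by norm_num)
  have h5 : Real.sqrt 5 ^ 2 = 5 := Real.sq_sqrt (by norm_num)
  have h30 : 0 < Real.sqrt 3 := by positivity
  have h50 : 0 < Real.sqrt 5 := by positivity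
  have hpi := Real.pi_pos
  set R0 := Real.sqrt 5 / (2 * Real.sqrt 3 * π * q) with hR0
  have hR00 : 0 < R0 := by positivity
  have hR3 : R0 ^ 3 = 5 * Real.sqrt 5 / (24 * Real.sqrt 3 * π ^ 3 * q ^ 3) := by
    rw [hR0, div_pow]
    have e1 : Real.sqrt 5 ^ 3 = 5 * Real.sqrt 5 := by rw [pow_succ, h5]
    have e2 : (2 * Real.sqrt 3 * π * q) ^ 3 = 24 * Real.sqrt 3 * π ^ 3 * q ^ 3 := by
      linear_combination 8 * Real.sqrt 3 * π ^ 3 * q ^ 3 * h3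
    rw [e1, e2]
  have hV0 : 3 / (4 * π * R0 ^ 3) = 18 * Real.sqrt 3 * Real.pi ^ 2 / (5 * Real.sqrt 5) *
      (d / r) ^ ((3 : ℝ) / 2) := by
    rw [hR3, hq3]
    field_simp
    ring
  have hR2 : d * (12 * π ^ 2 / 5) * R0 ^ 2 = r := by
    have e : R0 ^ 2 = 5 / (12 * π ^ 2 * q ^ 2) := by
      rw [hR0, div_pow, h5]
      congr 1
      linear_combination 4 * π ^ 2 * q ^ 2 * h3
    rw [e, hq2]
    field_simp
  rw [← hV0] at hv
  have hcont : ContinuousAt (fun R : ℝ => ENNReal.ofReal (3 / (4 * π * R ^ 3))) R0 := by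
    apply ENNReal.continuous_ofReal.continuousAt.comp
    apply ContinuousAt.div continuousAt_const (by fun_prop) (by positivity)
  have ev := (hcont.eventually (lt_mem_nhds hv)).filter_mono (nhdsWithin_le_nhds (s := Set.Ioi R0))
  obtain ⟨R, hR1, hR2'⟩ := (ev.and self_mem_nhdsWithin).exists
  have hRR : R0 < R := hR2'
  have hRpos : 0 < R := hR00.trans hRR
  have hc : d * (4*π^2*R^2*(1 - 3 / (4 * π * R ^ 3)*(8*π/15)*R^3)) = d * (12 * π ^ 2 / 5) * R ^ 2 := by
    field_simp
    ring
  have hgt : r < d * (12 * π ^ 2 / 5) * R ^ 2 := by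
    rw [← hR2]
    gcongr
  refine ⟨3 / (4 * π * R ^ 3), R, (r + d * (12 * π ^ 2 / 5) * R ^ 2) / 2, by positivity, hRpos,
    by linarith, hR1, ?_⟩
  rw [hc]; linarith

/-- Extinction on a smooth bounded domain in `ℝ³` of volume below the extreme volume size
`V_ex = (18√3·π²/(5√5))·(d/(f'(0)+ln g'(0)))^{3/2}`, with divergence free drift. -/
theorem extreme_volume_extinction_dim3
    (d : ℝ) (hd : 0 < d)
    (Ω : Set (EuclideanSpace ℝ (Fin 3)))
    (hopen : IsOpen Ω) (hne : Ω.Nonempty) (hbdd : Bornology.IsBounded Ω)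
    (hbd : HasCkBoundary ⊤ Ω)
    (a : EuclideanSpace ℝ (Fin 3) → EuclideanSpace ℝ (Fin 3))
    (ha : ContDiffOn ℝ 1 a (closure Ω))
    (hdiv : ∀ x ∈ Ω, (∑ i, pd (fun y => a y i) i x) = 0)
    (f g : ℝ → ℝ) (f'0 g'0 : ℝ) (hf : SatF f f'0) (hg : SatGext g g'0)
    (hpos : 0 < f'0 + Real.log g'0)
    (hvol : volume Ω < ENNReal.ofReal (18 * Real.sqrt 3 * Real.pi ^ 2 / (5 * Real.sqrt 5) *
      (d / (f'0 + Real.log g'0)) ^ ((3 : ℝ) / 2)))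
    (sol : ImpSol 3 Ω d a f g) :
    ∀ x ∈ Ω, Tendsto (fun m => sol.N m x) atTop (𝓝 0) := by
  obtain ⟨V, R, l, hV, hR, hl, hvV, hlc⟩ := choose_params d _ hd hpos _ hvol
  obtain ⟨φ, hφ, hφ1⟩ := exists_super Ω hopen hbdd hbd a ha hdiv d l V R (hpos.trans hl) hd hV hR
    hvV hlc
  obtain ⟨_, _, _, _, _, _, _, _, hfN⟩ := hf
  obtain ⟨-, hg0, -, -, hg'0, hgN⟩ := hg
  have hQ : IsCompact (closure Ω) := hbdd.isCompact_closure
  obtain ⟨C, hC⟩ := hQ.exists_bound_of_continuousOn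
    ((sol.N_cont 0).div hφ.continuous.continuousOn (fun x hx => (hφ1 x hx).1.ne'))
  set C0 := max C 1 with hC0
  have hC0p : 0 < C0 := lt_of_lt_of_le one_pos (le_max_right _ _)
  set ρ := g'0 * Real.exp (f'0 - l) with hρ
  have hρ0 : 0 < ρ := by positivity
  have hρ1 : ρ < 1 := by
    rw [hρ, ← Real.exp_log hg'0, ← Real.exp_add]
    rw [Real.exp_lt_one_iff]
    linarith
  have main : ∀ m, ∀ x ∈ closure Ω, sol.N m x ≤ C0 * ρ ^ m * φ x := by
    intro m
    induction m with
    | zero =>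
      intro x hx
      have h1 := (le_abs_self _).trans (hC x hx)
      have h2 := h1.trans (le_max_left C 1)
      rw [← hC0] at h2
      have h3 : sol.N 0 x / φ x ≤ C0 := h2
      rw [div_le_iff₀ (hφ1 x hx).1] at h3
      simpa using h3
    | succ m ih =>
      have hB : 0 < C0 * ρ ^ m * g'0 := by positivity
      have hi : ∀ x ∈ Ω, sol.u m x 0 ≤ C0 * ρ ^ m * g'0 * φ x := by
        intro x hx
        have hxc := subset_closure hx
        rw [sol.init m x hx]
        have h1 : g (sol.N m x) ≤ g'0 * sol.N m x := by
          rcases (sol.N_nonneg m x hxc).eq_or_lt with h | h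
          · rw [← h, hg0]; simp
          · exact hgN _ h
        have h2 := mul_le_mul_of_nonneg_left (ih x hxc) hg'0.le
        linarith
      have hi2 : ∀ x ∈ closure Ω, sol.u m x 0 ≤ C0 * ρ ^ m * g'0 * φ x := by
        intro x hx
        have hcu : ContinuousOn (fun y => sol.u m y 0) (closure Ω) := by
          have h1 : ContinuousOn (fun y : E3 => (y, (0:ℝ))) (closure Ω) := by fun_prop
          exact (sol.u_cont m).comp h1 (fun y hy => ⟨hy, by simp⟩)
        exact ContinuousWithinAt.closure_le hx ((hcu x hx).mono subset_closure)
          (hφ.continuous.const_smul (C0 * ρ ^ m * g'0)).continuousWithinAt hi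
      have hc := compare_super Ω hopen hbdd a d l f'0 _ hd hB f (fun N hN => (hfN N hN).2) φ hφ hφ1
        (sol.u m) (sol.u_nonneg m) (sol.u_cont m) (sol.u_space_C2 m) (sol.u_time_C1 m) (sol.pde m)
        (sol.bdry m) hi2
      intro x hx
      rw [sol.recur m x hx]
      refine (hc x hx).trans (le_of_eq ?_)
      rw [pow_succ, hρ]
      ring
  intro x hx
  have hxc := subset_closure hx
  refine squeeze_zero (fun m => sol.N_nonneg m x hxc) (fun m => main m x hxc) ?_
  have h1 := tendsto_pow_atTop_nhds_zero_of_lt_one hρ0.le hρ1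
  have h2 := (h1.const_mul C0).mul_const (φ x)
  simpa using h2
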